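/- arXiv:2208.09301 — 2 statements merged into one kernel-verified Lean document; each statement's English description precedes it below -/
import Mathlib

section
/- Let m ≥ 3 and consider the action of SO(m, ℂ) × SL(2, ℂ) on ℂ^m ⊗ ℂ² given by (A, B)·(v ⊗ w) = (Av) ⊗ (Bw), with the induced action on the exterior powers ⋀^k (ℂ^m ⊗ ℂ²). Then for every k ≥ 0, the dimension of the space of SO(m, ℂ) × SL(2, ℂ)-invariant elements of ⋀^k (ℂ^m ⊗ ℂ²) equals 1 if k is even and 0 ≤ k ≤ 2m, and equals 0 if k is odd. (This is the dimension count dim_ℂ ⋀^k_inv(U) used for the isotropy representation U of the homogeneous 3-Sasakian space SO(n+3)/(SO(n−1)×Sp(1)), with m = n−1; in the middle degree k = m the invariant line is spanned by the (m/2)-th power of 𝓘 := Σ_{i=1}^{m}(e_i⊗f₁)∧(e_i⊗f₂), where e_i and f₁, f₂ are the standard bases of ℂ^m and ℂ².) -/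
set_option synthInstance.maxHeartbeats 1000000
set_option maxHeartbeats 1000000

noncomputable section

open scoped TensorProduct

/-- `ℂ^m ⊗ ℂ²`. -/
abbrev TensorRep (m : ℕ) : Type := (Fin m → ℂ) ⊗[ℂ] (Fin 2 → ℂ)

/-- The subalgebra of `SO(m,ℂ) × SL(2,ℂ)`-invariant elements of the exterior algebra
`⋀•(ℂ^m ⊗ ℂ²)`, where `(A,B)·(v ⊗ w) = (Av) ⊗ (Bw)`. -/
def soSlInvAlg (m : ℕ) : Subalgebra ℂ (ExteriorAlgebra ℂ (TensorRep m)) where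
  carrier := {x | ∀ A : Matrix (Fin m) (Fin m) ℂ, A.transpose * A = 1 → A.det = 1 →
    ∀ B : Matrix (Fin 2) (Fin 2) ℂ, B.det = 1 →
      ExteriorAlgebra.map (TensorProduct.map A.mulVecLin B.mulVecLin) x = x}
  mul_mem' := fun hx hy => fun A hA hA' B hB => by
    rw [map_mul, hx A hA hA' B hB, hy A hA hA' B hB]
  one_mem' := fun A hA hA' B hB => by rw [map_one]
  add_mem' := fun hx hy => fun A hA hA' B hB => by
    rw [map_add, hx A hA hA' B hB, hy A hA hA' B hB]
  zero_mem' := fun A hA hA' B hB => by rw [map_zero]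
  algebraMap_mem' := fun r => fun A hA hA' B hB => by rw [AlgHom.commutes]

section Commuting

variable {R : Type*} [Ring R]

theorem add_pow_succ_of_mul_self_eq_zero {z N : R} (h : Commute z N) (hz : z * z = 0) (n : ℕ) :
    (z + N) ^ (n + 1) = N ^ (n + 1) + (n + 1 : ℕ) • (z * N ^ n) := by
  induction n with
  | zero => simp [add_comm]
  | succ n ih =>
    have h1 : z * N ^ n * z = 0 := by
      rw [mul_assoc, ← (h.pow_right n).eq, ← mul_assoc, hz, zero_mul]
    rw [pow_succ, ih, add_mul, mul_add, smul_mul_assoc, mul_add, h1, zero_add, mul_assoc z,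
      ← pow_succ, ← pow_succ, ← (h.pow_right (n + 1)).eq, succ_nsmul _ (n + 1)]
    abel

theorem sum_pow_of_commute_of_mul_self_eq_zero (n : ℕ) (z : Fin n → R)
    (hc : ∀ i j, Commute (z i) (z j)) (hz : ∀ i, z i * z i = 0) :
    (∑ i, z i) ^ n = n.factorial • (List.ofFn z).prod ∧ (∑ i, z i) ^ (n + 1) = 0 := by
  induction n with
  | zero => simp
  | succ n ih =>
    obtain ⟨h1, h2⟩ := ih (fun i => z i.succ) (fun i j => hc _ _) (fun i => hz _)
    have h0 : Commute (z 0) (∑ i : Fin n, z i.succ) :=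
      Commute.sum_right _ _ _ fun i _ => hc _ _
    rw [Fin.sum_univ_succ]
    refine ⟨?_, ?_⟩
    · rw [add_pow_succ_of_mul_self_eq_zero h0 (hz 0), h2, zero_add, h1, List.ofFn_succ,
        List.prod_cons, mul_smul_comm, smul_smul, Nat.factorial_succ]
    · rw [add_pow_succ_of_mul_self_eq_zero h0 (hz 0), h2, pow_succ, h2, zero_mul, mul_zero,
        smul_zero, add_zero]

end Commuting

section Exterior

variable {R M : Type*} [CommRing R] [AddCommGroup M] [Module R M]

open ExteriorAlgebra in
theorem ExteriorAlgebra.ι_mul_ι_swap (x y : M) : ι R x * ι R y = -(ι R y * ι R x) :=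
  eq_neg_of_add_eq_zero_left (ι_add_mul_swap x y)

open ExteriorAlgebra in
theorem ExteriorAlgebra.commute_ι_mul_ι_ι (x y u : M) : Commute (ι R x * ι R y) (ι R u) := by
  rw [Commute, SemiconjBy, mul_assoc, ι_mul_ι_swap y u, mul_neg, ← mul_assoc, ι_mul_ι_swap x u,
    neg_mul, neg_neg, mul_assoc]

open ExteriorAlgebra in
theorem ExteriorAlgebra.commute_ι_mul_ι (x y u v : M) :
    Commute (ι R x * ι R y) (ι R u * ι R v) :=
  (commute_ι_mul_ι_ι x y u).mul_right (commute_ι_mul_ι_ι x y v)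

open ExteriorAlgebra in
theorem ExteriorAlgebra.ι_mul_ι_mul_self (x y : M) :
    ι R x * ι R y * (ι R x * ι R y) = 0 := by
  rw [← mul_assoc, (commute_ι_mul_ι_ι x y x).eq, ← mul_assoc, ι_sq_zero, zero_mul, zero_mul]

open ExteriorAlgebra in
theorem ExteriorAlgebra.ιMulti_basis_ne_zero [Nontrivial R] {n : ℕ}
    (b : Module.Basis (Fin n) R M) : ιMulti R n b ≠ 0 := by
  intro h
  have h1 : liftAlternating (R := R) (Pi.single n b.det) (ιMulti R n b) = 1 := by
    rw [liftAlternating_apply_ιMulti, Pi.single_eq_same, b.det_self]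
  rw [h, map_zero] at h1
  exact zero_ne_one h1

end Exterior

/-- The basis `e_i ⊗ f_a` of `ℂ^m ⊗ ℂ²`. -/
def stdTensorBasis (m : ℕ) : Module.Basis (Fin m × Fin 2) ℂ (TensorRep m) :=
  (Pi.basisFun ℂ (Fin m)).tensorProduct (Pi.basisFun ℂ (Fin 2))

theorem stdTensorBasis_apply (m : ℕ) (p : Fin m × Fin 2) :
    stdTensorBasis m p = Pi.single p.1 1 ⊗ₜ Pi.single p.2 1 := by
  simp [stdTensorBasis, Module.Basis.tensorProduct_apply']

/-- The action of `(A, B)` on `ℂ^m ⊗ ℂ²`. -/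
abbrev tensorAct {m : ℕ} (A : Matrix (Fin m) (Fin m) ℂ) (B : Matrix (Fin 2) (Fin 2) ℂ) :
    TensorRep m →ₗ[ℂ] TensorRep m :=
  TensorProduct.map A.mulVecLin B.mulVecLin

theorem tensorAct_stdTensorBasis {m : ℕ} (A : Matrix (Fin m) (Fin m) ℂ)
    (B : Matrix (Fin 2) (Fin 2) ℂ) (p : Fin m × Fin 2) :
    tensorAct A B (stdTensorBasis m p) =
      ∑ q : Fin m × Fin 2, (A q.1 p.1 * B q.2 p.2) • stdTensorBasis m q := by
  have h (n : ℕ) (C : Matrix (Fin n) (Fin n) ℂ) (j : Fin n) :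
      C.mulVecLin (Pi.single j 1) = ∑ i, C i j • (Pi.single i 1 : Fin n → ℂ) := by
    ext r
    simp [Finset.sum_apply, Pi.single_apply]
  rw [stdTensorBasis_apply, tensorAct, TensorProduct.map_tmul, h, h, TensorProduct.sum_tmul,
    Fintype.sum_prod_type]
  simp only [TensorProduct.tmul_sum, TensorProduct.smul_tmul_smul, stdTensorBasis_apply]

open ExteriorAlgebra in
/-- The quadratic invariant `∑ i, (e_i ⊗ f_1) ∧ (e_i ⊗ f_2)`. -/
def quadInv (m : ℕ) : ExteriorAlgebra ℂ (TensorRep m) :=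
  ∑ i : Fin m, ι ℂ (stdTensorBasis m (i, 0)) * ι ℂ (stdTensorBasis m (i, 1))

open ExteriorAlgebra in
theorem quadInv_mem (m : ℕ) : quadInv m ∈ soSlInvAlg m := by
  intro A hA _ B hB
  have hA' : A * A.transpose = 1 := mul_eq_one_comm.mp hA
  have hAA (r s : Fin m) : ∑ i, A r i * A s i = if r = s then 1 else 0 := by
    have := congrFun (congrFun hA' r) s
    simpa [Matrix.mul_apply, Matrix.one_apply] using this
  set w : Fin m → Fin 2 → ExteriorAlgebra ℂ (TensorRep m) := fun r a =>
    ∑ c, B c a • ι ℂ (stdTensorBasis m (r, c)) with hw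
  have hact (i : Fin m) (a : Fin 2) :
      ι ℂ (tensorAct A B (stdTensorBasis m (i, a))) = ∑ r, A r i • w r a := by
    simp only [tensorAct_stdTensorBasis, Fintype.sum_prod_type, map_sum, map_smul, hw,
      Finset.smul_sum, smul_smul]
  have hdet (r : Fin m) : w r 0 * w r 1 =
      ι ℂ (stdTensorBasis m (r, 0)) * ι ℂ (stdTensorBasis m (r, 1)) := by
    rw [Matrix.det_fin_two] at hB
    simp only [hw, Fin.sum_univ_two, add_mul, mul_add, smul_mul_smul_comm, ι_sq_zero, smul_zero,
      zero_add, add_zero, ι_mul_ι_swap (stdTensorBasis m (r, 1)) (stdTensorBasis m (r, 0)),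
      smul_neg]
    rw [← sub_eq_neg_add, ← sub_smul, mul_comm (B 1 0), hB, one_smul]
  calc ExteriorAlgebra.map (tensorAct A B) (quadInv m)
      = ∑ i, (∑ r, A r i • w r 0) * (∑ s, A s i • w s 1) := by
        simp only [quadInv, map_sum, map_mul, map_apply_ι, hact]
    _ = ∑ r, ∑ s, (∑ i, A r i * A s i) • (w r 0 * w s 1) := by
        simp only [Finset.sum_mul_sum, smul_mul_smul_comm, Finset.sum_smul]
        rw [Finset.sum_comm]
        exact Finset.sum_congr rfl fun r _ => Finset.sum_comm
    _ = quadInv m := by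
        simp only [hAA, ite_smul, one_smul, zero_smul, Finset.sum_ite_eq, Finset.mem_univ, if_true,
          hdet, quadInv]

open ExteriorAlgebra in
theorem quadInv_pow_mem_exteriorPower (m j : ℕ) :
    quadInv m ^ j ∈ ⋀[ℂ]^(2 * j) (TensorRep m) := by
  have h : quadInv m ∈ ⋀[ℂ]^2 (TensorRep m) := by
    refine Submodule.sum_mem _ fun i _ => ?_
    rw [exteriorPower, pow_two]
    exact Submodule.mul_mem_mul (LinearMap.mem_range_self _ _) (LinearMap.mem_range_self _ _)
  rw [exteriorPower, pow_mul]
  exact Submodule.pow_mem_pow _ h j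

open ExteriorAlgebra in
theorem quadInv_pow_ne_zero {m j : ℕ} (hj : j ≤ m) : quadInv m ^ j ≠ 0 := by
  suffices h : quadInv m ^ m ≠ 0 from fun h0 => h (pow_eq_zero_of_le hj h0)
  rw [quadInv, (sum_pow_of_commute_of_mul_self_eq_zero m _ (fun _ _ => commute_ι_mul_ι _ _ _ _)
    (fun _ => ι_mul_ι_mul_self _ _)).1]
  rw [← Nat.cast_smul_eq_nsmul ℂ]
  refine smul_ne_zero (Nat.cast_ne_zero.mpr m.factorial_ne_zero) ?_
  have h := ιMulti_basis_ne_zero ((stdTensorBasis m).reindex finProdFinEquiv)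
  have hidx (i : Fin m) (c : Fin 2) (hlt : (i * 2 + c : ℕ) < m * 2) :
      finProdFinEquiv.symm ⟨i * 2 + c, hlt⟩ = (i, c) := by
    rw [Equiv.symm_apply_eq]
    ext
    simp [add_comm, mul_comm]
  rw [ιMulti_apply, List.ofFn_mul, List.prod_flatten, List.map_ofFn] at h
  simp only [Module.Basis.reindex_apply, hidx] at h
  convert h using 4 with i
  simp [List.ofFn_succ]

/-- Invariance of an alternating form on `ℂ^m ⊗ ℂ²` under `SO(m, ℂ) × SL(2, ℂ)`. -/
def IsSoSlInvariant {m k : ℕ} (φ : TensorRep m [⋀^Fin k]→ₗ[ℂ] ℂ) : Prop :=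
  ∀ A : Matrix (Fin m) (Fin m) ℂ, A.transpose * A = 1 → A.det = 1 →
    ∀ B : Matrix (Fin 2) (Fin 2) ℂ, B.det = 1 → ∀ v, φ (fun l => tensorAct A B (v l)) = φ v

section Pairing

variable {m k : ℕ}

/-- The alternating form on `ℂ^m ⊗ ℂ²` obtained by pairing with an element of the exterior
power through the standard bilinear form. -/
def pairingForm (x : ⋀[ℂ]^k (TensorRep m)) : TensorRep m [⋀^Fin k]→ₗ[ℂ] ℂ :=
  (LinearMap.applyₗ x).compAlternatingMap
    ((exteriorPower.alternatingMapToDual ℂ (TensorRep m) k).compLinearMap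
      (stdTensorBasis m).toDual)

theorem pairingForm_apply (x : ⋀[ℂ]^k (TensorRep m)) (v : Fin k → TensorRep m) :
    pairingForm x v = exteriorPower.pairingDual ℂ (TensorRep m) k
      (exteriorPower.ιMulti ℂ k fun l => (stdTensorBasis m).toDual (v l)) x := by
  simp only [exteriorPower.pairingDual, exteriorPower.alternatingMapLinearEquiv_apply_ιMulti]
  rfl

theorem pairingForm_sub (x y : ⋀[ℂ]^k (TensorRep m)) (v : Fin k → TensorRep m) :
    pairingForm (x - y) v = pairingForm x v - pairingForm y v := by
  simp only [pairingForm_apply, map_sub]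

theorem pairingForm_smul (c : ℂ) (x : ⋀[ℂ]^k (TensorRep m)) (v : Fin k → TensorRep m) :
    pairingForm (c • x) v = c * pairingForm x v := by
  simp only [pairingForm_apply, map_smul, smul_eq_mul]

theorem toDual_tensorAct_transpose (A : Matrix (Fin m) (Fin m) ℂ) (B : Matrix (Fin 2) (Fin 2) ℂ)
    (v w : TensorRep m) :
    (stdTensorBasis m).toDual (tensorAct A.transpose B.transpose v) w =
      (stdTensorBasis m).toDual v (tensorAct A B w) := by
  suffices h : (stdTensorBasis m).toDual ∘ₗ tensorAct A.transpose B.transpose =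
      (tensorAct A B).dualMap ∘ₗ (stdTensorBasis m).toDual from
    LinearMap.congr_fun (LinearMap.congr_fun h v) w
  refine (stdTensorBasis m).ext fun p => (stdTensorBasis m).ext fun q => ?_
  simp only [LinearMap.comp_apply, LinearMap.dualMap_apply, tensorAct_stdTensorBasis, map_sum,
    map_smul, LinearMap.sum_apply, LinearMap.smul_apply, Module.Basis.toDual_apply]
  simp

theorem pairingForm_map (A : Matrix (Fin m) (Fin m) ℂ) (B : Matrix (Fin 2) (Fin 2) ℂ)
    (x : ⋀[ℂ]^k (TensorRep m)) (v : Fin k → TensorRep m) :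
    pairingForm x (fun l => tensorAct A.transpose B.transpose (v l)) =
      pairingForm (exteriorPower.map k (tensorAct A B) x) v := by
  rw [pairingForm_apply, pairingForm_apply, ← LinearMap.comp_apply]
  revert x
  rw [← LinearMap.ext_iff]
  ext u
  simp only [LinearMap.compAlternatingMap_apply, LinearMap.comp_apply,
    exteriorPower.map_apply_ιMulti, exteriorPower.pairingDual_ιMulti_ιMulti,
    toDual_tensorAct_transpose, Function.comp_apply]

theorem coe_exteriorPower_map (f : TensorRep m →ₗ[ℂ] TensorRep m) (x : ⋀[ℂ]^k (TensorRep m)) :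
    (exteriorPower.map k f x : ExteriorAlgebra ℂ (TensorRep m)) = ExteriorAlgebra.map f x := by
  suffices h : (⋀[ℂ]^k (TensorRep m)).subtype ∘ₗ exteriorPower.map k f =
      (ExteriorAlgebra.map f).toLinearMap ∘ₗ (⋀[ℂ]^k (TensorRep m)).subtype from
    LinearMap.congr_fun h x
  ext u
  simp [exteriorPower.map_apply_ιMulti, ExteriorAlgebra.map_apply_ιMulti]

theorem isSoSlInvariant_pairingForm {x : ⋀[ℂ]^k (TensorRep m)}
    (hx : (x : ExteriorAlgebra ℂ (TensorRep m)) ∈ soSlInvAlg m) :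
    IsSoSlInvariant (pairingForm x) := by
  intro A hA hA' B hB v
  have h := pairingForm_map A.transpose B.transpose x v
  rw [Matrix.transpose_transpose, Matrix.transpose_transpose] at h
  rw [h]
  congr 1
  congr 1
  refine Subtype.ext ?_
  rw [coe_exteriorPower_map]
  exact hx _ (by rw [Matrix.transpose_transpose]; exact mul_eq_one_comm.mp hA)
    (by rw [Matrix.det_transpose, hA']) _ (by rw [Matrix.det_transpose, hB])

theorem eq_zero_of_pairingForm {x : ⋀[ℂ]^k (TensorRep m)}
    (hx : ∀ t : Fin k → Fin m × Fin 2, pairingForm x (fun l => stdTensorBasis m (t l)) = 0) :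
    x = 0 := by
  let b' := (stdTensorBasis m).reindex (toLex : Fin m × Fin 2 ≃ Fin m ×ₗ Fin 2)
  refine (b'.exteriorPower k).ext_elem fun s => ?_
  rw [exteriorPower.basis_repr_apply, map_zero, Finsupp.zero_apply, exteriorPower.ιMultiDual,
    exteriorPower.ιMulti_family]
  rw [← hx fun l => ofLex (Set.powersetCard.ofFinEmbEquiv.symm s l), pairingForm_apply]
  congr 3
  ext l : 1
  refine (stdTensorBasis m).ext fun p => ?_
  simp [b', Module.Basis.toDual_apply, Finsupp.single_apply, eq_comm]
  exact if_congr Iff.rfl rfl rfl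

end Pairing

theorem exists_perm_mem_iff_of_card_eq {α : Type*} [Fintype α] [DecidableEq α] {s t : Finset α}
    (h : s.card = t.card) : ∃ σ : Equiv.Perm α, ∀ x, x ∈ s ↔ σ x ∈ t := by
  let e : {x // x ∈ s} ≃ {x // x ∈ t} := Finset.equivOfCardEq h
  refine ⟨e.extendSubtype, fun x => ⟨e.extendSubtype_mem x, fun hx => ?_⟩⟩
  by_contra hxs
  exact e.extendSubtype_not_mem x hxs hx

section Invariant

variable {m k : ℕ} {φ : TensorRep m [⋀^Fin k]→ₗ[ℂ] ℂ}

/-- The value of an alternating form at a tuple of basis vectors. -/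
def basisValue (φ : TensorRep m [⋀^Fin k]→ₗ[ℂ] ℂ) (t : Fin k → Fin m × Fin 2) : ℂ :=
  φ fun l => stdTensorBasis m (t l)

theorem tensorAct_eq_smul_of_monomial (A : Matrix (Fin m) (Fin m) ℂ) (B : Matrix (Fin 2) (Fin 2) ℂ)
    (σ : Equiv.Perm (Fin m)) (a : Fin m → ℂ) (c : Fin 2 → ℂ)
    (hA : ∀ i j, A i j = if i = σ j then a j else 0) (hB : B = Matrix.diagonal c)
    (p : Fin m × Fin 2) :
    tensorAct A B (stdTensorBasis m p) = (a p.1 * c p.2) • stdTensorBasis m (σ p.1, p.2) := by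
  rw [tensorAct_stdTensorBasis, Finset.sum_eq_single (σ p.1, p.2)]
  · simp [hA, hB]
  · intro q _ hq
    by_cases h1 : q.1 = σ p.1
    · have h2 : q.2 ≠ p.2 := fun h2 => hq (Prod.ext h1 h2)
      simp [hB, Matrix.diagonal_apply_ne _ h2]
    · simp [hA, h1]
  · simp

theorem prod_mul_basisValue_of_monomial (hφ : IsSoSlInvariant φ) (A : Matrix (Fin m) (Fin m) ℂ)
    (σ : Equiv.Perm (Fin m)) (a : Fin m → ℂ) (c : Fin 2 → ℂ)
    (hA : ∀ i j, A i j = if i = σ j then a j else 0) (hA1 : A.transpose * A = 1)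
    (hA2 : A.det = 1) (hc : c 0 * c 1 = 1) (t : Fin k → Fin m × Fin 2) :
    (∏ l, (a (t l).1 * c (t l).2)) * basisValue φ (fun l => (σ (t l).1, (t l).2)) =
      basisValue φ t := by
  have h := hφ A hA1 hA2 (Matrix.diagonal c) (by simp [Matrix.det_diagonal, hc])
    (fun l => stdTensorBasis m (t l))
  simp only [tensorAct_eq_smul_of_monomial A _ σ a c hA rfl] at h
  rw [AlternatingMap.map_smul_univ] at h
  exact h

theorem card_filter_snd_eq (hφ : IsSoSlInvariant φ) {t : Fin k → Fin m × Fin 2}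
    (ht : basisValue φ t ≠ 0) :
    (Finset.univ.filter fun l => (t l).2 = 0).card =
      (Finset.univ.filter fun l => ¬ (t l).2 = 0).card := by
  have h := prod_mul_basisValue_of_monomial hφ 1 1 1 ![2, 2⁻¹]
    (fun i j => by rw [Matrix.one_apply]; congr) (by simp) (by simp) (by simp) t
  have h1 := mul_right_cancel₀ ht (h.trans (one_mul _).symm)
  have h2 (a : Fin 2) : (![2, 2⁻¹] : Fin 2 → ℂ) a = if a = 0 then 2 else 2⁻¹ := by
    fin_cases a <;> simp
  simp only [Pi.one_apply, one_mul, h2, Finset.prod_ite, Finset.prod_const, inv_pow] at h1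
  rw [mul_inv_eq_one₀ (pow_ne_zero _ two_ne_zero)] at h1
  have h3 : 2 ^ (Finset.univ.filter fun l => (t l).2 = 0).card =
      2 ^ (Finset.univ.filter fun l => ¬ (t l).2 = 0).card := by exact_mod_cast h1
  exact Nat.pow_right_injective le_rfl h3

/-- The number of entries of a tuple lying over the index `i`. -/
def fiberCard (t : Fin k → Fin m × Fin 2) (i : Fin m) : ℕ :=
  (Finset.univ.filter fun l => (t l).1 = i).card

theorem prod_ite_neg_one (t : Fin k → Fin m × Fin 2) (i : Fin m) :
    ∏ l, (if (t l).1 = i then -1 else 1 : ℂ) = (-1) ^ fiberCard t i := by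
  simp [Finset.prod_ite, fiberCard]

theorem neg_one_pow_fiberCard_eq (hφ : IsSoSlInvariant φ) {t : Fin k → Fin m × Fin 2}
    (ht : basisValue φ t ≠ 0) (i j : Fin m) :
    (-1 : ℂ) ^ fiberCard t i = (-1) ^ fiberCard t j := by
  let a : Fin m → ℂ := fun r => (if r = i then -1 else 1) * (if r = j then -1 else 1)
  have ha (r : Fin m) : a r * a r = 1 := by
    simp only [a]; split_ifs <;> norm_num
  have h := prod_mul_basisValue_of_monomial hφ (Matrix.diagonal a) 1 a 1
    (fun r s => by
      by_cases hrs : r = s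
      · simp [hrs]
      · simp [hrs])
    (by simp [ha]) (by rw [Matrix.det_diagonal, Finset.prod_mul_distrib]; simp) (by simp) t
  have h1 := mul_right_cancel₀ ht (h.trans (one_mul _).symm)
  simp only [Pi.one_apply, mul_one, a, Finset.prod_mul_distrib, prod_ite_neg_one] at h1
  rcases neg_one_pow_eq_or ℂ (fiberCard t j) with h2 | h2
  · rw [h2] at h1 ⊢; simpa using h1
  · rw [h2] at h1 ⊢; linear_combination -h1

theorem basisValue_swap (hφ : IsSoSlInvariant φ) (t : Fin k → Fin m × Fin 2) {i j : Fin m}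
    (hij : i ≠ j) :
    (-1) ^ fiberCard t j * basisValue φ (fun l => (Equiv.swap i j (t l).1, (t l).2)) =
      basisValue φ t := by
  let a : Fin m → ℂ := fun r => if r = j then -1 else 1
  let P : Matrix (Fin m) (Fin m) ℂ := (Equiv.swap i j).permMatrix ℂ
  have ha (r : Fin m) : a r * a r = 1 := by
    simp only [a]; split_ifs <;> norm_num
  have hP : P.transpose * P = 1 := by
    simp [P, Matrix.transpose_permMatrix, ← Matrix.permMatrix_mul]
  have h := prod_mul_basisValue_of_monomial hφ (P * Matrix.diagonal a) (Equiv.swap i j) a 1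
    (fun r s => by
      rw [Matrix.mul_diagonal]
      simp only [P, Equiv.Perm.permMatrix, PEquiv.toMatrix_apply, Equiv.toPEquiv_apply,
        Option.mem_some_iff, ite_mul, one_mul, zero_mul]
      refine if_congr ?_ rfl rfl
      rw [Equiv.swap_apply_eq_iff])
    (by
      rw [Matrix.transpose_mul, Matrix.mul_assoc, ← Matrix.mul_assoc P.transpose, hP]
      simp [ha])
    (by
      simp [P, Matrix.det_permutation, Equiv.Perm.sign_swap hij, a])
    (by simp) t
  simpa only [Pi.one_apply, mul_one, a, prod_ite_neg_one] using h

theorem fiberCard_perm (t : Fin k → Fin m × Fin 2) (σ : Equiv.Perm (Fin m)) (i : Fin m) :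
    fiberCard (fun l => (σ (t l).1, (t l).2)) i = fiberCard t (σ.symm i) := by
  simp only [fiberCard, ← Equiv.eq_symm_apply]

theorem basisValue_perm (hφ : IsSoSlInvariant φ) (χ : Equiv.Perm (Fin m) →* ℂ) (ε : ℂ)
    (hχ : ∀ i j, i ≠ j → χ (Equiv.swap i j) = ε) (σ : Equiv.Perm (Fin m)) :
    ∀ t : Fin k → Fin m × Fin 2, (∀ i, (-1) ^ fiberCard t i = ε) →
      χ σ * basisValue φ (fun l => (σ (t l).1, (t l).2)) = basisValue φ t := by
  induction σ using Equiv.Perm.swap_induction_on with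
  | one => intro t _; simp
  | swap_mul f x y hxy ih =>
    intro t ht
    rw [← ih t ht, map_mul, hχ x y hxy, mul_comm ε, mul_assoc]
    have h := basisValue_swap hφ (fun l => (f (t l).1, (t l).2)) hxy
    rw [fiberCard_perm, ht] at h
    rw [← h]
    rfl

theorem fiberCard_le_two {t : Fin k → Fin m × Fin 2} (ht : Function.Injective t) (i : Fin m) :
    fiberCard t i ≤ 2 := by
  refine (Finset.card_le_card_of_injOn (t := (Finset.univ : Finset (Fin 2))) (fun l => (t l).2)
    (fun _ _ => Finset.mem_univ _) ?_).trans_eq (by simp)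
  intro l hl l' hl' h
  simp only [Finset.mem_coe, Finset.mem_filter, Finset.mem_univ, true_and] at hl hl'
  exact ht (Prod.ext (hl.trans hl'.symm) h)

theorem injective_of_basisValue_ne_zero {t : Fin k → Fin m × Fin 2} (ht : basisValue φ t ≠ 0) :
    Function.Injective t := by
  by_contra h
  refine ht (AlternatingMap.map_eq_zero_of_not_injective _ _ fun h' => h ?_)
  exact Function.Injective.of_comp h'

theorem basisValue_comp_perm (φ : TensorRep m [⋀^Fin k]→ₗ[ℂ] ℂ) (t : Fin k → Fin m × Fin 2)
    (τ : Equiv.Perm (Fin k)) :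
    basisValue φ (t ∘ τ) = (Equiv.Perm.sign τ : ℤ) * basisValue φ t := by
  have h := φ.map_perm (fun l => stdTensorBasis m (t l)) τ
  rw [Units.smul_def, zsmul_eq_mul] at h
  exact h

/-- The sign character with values in `ℂ`. -/
def complexSign (m : ℕ) : Equiv.Perm (Fin m) →* ℂ :=
  ((Int.castRingHom ℂ : ℤ →* ℂ).comp (Units.coeHom ℤ)).comp Equiv.Perm.sign

theorem complexSign_apply (σ : Equiv.Perm (Fin m)) :
    complexSign m σ = ((Equiv.Perm.sign σ : ℤ) : ℂ) := rfl

theorem basisValue_comp_snd_perm (hφ : IsSoSlInvariant φ) (e : Fin k ≃ Fin m) (a : Fin k → Fin 2)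
    (τ : Equiv.Perm (Fin k)) :
    basisValue φ (fun l => (e l, a (τ l))) = basisValue φ (fun l => (e l, a l)) := by
  have hone (i : Fin m) : fiberCard (fun l => (e l, a l)) i = 1 := by
    rw [fiberCard, Finset.card_eq_one]
    exact ⟨e.symm i, by ext l; simp [Equiv.eq_symm_apply]⟩
  let σ : Equiv.Perm (Fin m) := (e.symm.trans τ.symm).trans e
  have hσ : Equiv.Perm.sign σ = Equiv.Perm.sign τ := by
    rw [Equiv.Perm.sign_symm_trans_trans, Equiv.Perm.sign_symm]
  have h1 := basisValue_perm hφ (complexSign m) (-1)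
    (fun i j hij => by simp [complexSign_apply, Equiv.Perm.sign_swap hij]) σ
    (fun l => (e l, a l)) (fun i => by rw [hone, pow_one])
  have h2 := basisValue_comp_perm φ (fun l => (σ (e l), a l)) τ
  have h3 : (fun l => (σ (e l), a l)) ∘ τ = fun l => (e l, a (τ l)) := by
    ext l : 1
    simp [σ]
  rw [h3] at h2
  rw [h2, ← h1, complexSign_apply, hσ]

theorem map_add_basis_eq_zero (hφ : IsSoSlInvariant φ) (hk : k ≠ 0) (e : Fin k → Fin m) :
    φ (fun l => stdTensorBasis m (e l, 1) + stdTensorBasis m (e l, 0)) = 0 := by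
  have h := hφ 1 (by simp) (by simp) !![2⁻¹, 3/2; 0, 2] (by simp [Matrix.det_fin_two])
    (fun l => stdTensorBasis m (e l, 1) + stdTensorBasis m (e l, 0))
  have h2 (i : Fin m) : tensorAct 1 !![2⁻¹, 3/2; 0, 2]
      (stdTensorBasis m (i, 1) + stdTensorBasis m (i, 0)) =
      (2 : ℂ) • (stdTensorBasis m (i, 1) + stdTensorBasis m (i, 0)) := by
    simp only [map_add, tensorAct_stdTensorBasis, Fintype.sum_prod_type, Matrix.one_apply, ite_mul,
      ite_smul, one_mul, zero_mul, zero_smul, Fin.sum_univ_two, Finset.sum_add_distrib,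
      Finset.sum_ite_eq', Finset.mem_univ, if_true]
    simp
    module
  simp only [h2] at h
  rw [AlternatingMap.map_smul_univ (c := fun _ => (2 : ℂ))] at h
  rw [Finset.prod_const, Finset.card_univ, Fintype.card_fin, smul_eq_mul] at h
  have h3 : ((2 : ℂ) ^ k - 1) ≠ 0 := by
    rw [sub_ne_zero]
    exact_mod_cast (Nat.one_lt_two_pow hk).ne'
  refine (mul_eq_zero.mp (?_ : ((2 : ℂ) ^ k - 1) * _ = 0)).resolve_left h3
  linear_combination h

theorem basisValue_eq_zero_of_bijective (hφ : IsSoSlInvariant φ) (hk : k ≠ 0) (e : Fin k ≃ Fin m)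
    (a : Fin k → Fin 2) : basisValue φ (fun l => (e l, a l)) = 0 := by
  by_contra hne
  have hadd := map_add_basis_eq_zero hφ hk e
  let u : Finset (Fin k) → Fin k → Fin 2 := fun s l => if l ∈ s then 1 else 0
  let s₀ : Finset (Fin k) := Finset.univ.filter fun l => ¬ a l = 0
  have ha : a = u s₀ := by
    ext l : 1
    simp only [u, s₀, Finset.mem_filter, Finset.mem_univ, true_and]
    split_ifs with h <;> omega
  have hs₀ : s₀.card = s₀ᶜ.card := by
    have := card_filter_snd_eq hφ hne
    rw [Finset.compl_filter, ← this]
    simp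
  have hval (s : Finset (Fin k)) : basisValue φ (fun l => (e l, u s l)) =
      if s.card = s₀.card then basisValue φ (fun l => (e l, a l)) else 0 := by
    split_ifs with h
    · obtain ⟨τ, hτ⟩ : ∃ τ : Equiv.Perm (Fin k), ∀ l, l ∈ s ↔ τ l ∈ s₀ :=
        exists_perm_mem_iff_of_card_eq h
      rw [← basisValue_comp_snd_perm hφ e a τ, ha]
      simp only [u, hτ]
    · by_contra h0
      have h1 := card_filter_snd_eq hφ h0
      refine h ?_
      have h2 : (Finset.univ.filter fun l => u s l = 0) = sᶜ := by ext; simp [u]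
      have h3 : (Finset.univ.filter fun l => ¬ u s l = 0) = s := by ext; simp [u]
      simp only [h2, h3] at h1
      have := s.card_add_card_compl
      have := s₀.card_add_card_compl
      omega
  have hsum := φ.map_add_univ (fun l => stdTensorBasis m (e l, 1))
    (fun l => stdTensorBasis m (e l, 0))
  have hexp (s : Finset (Fin k)) : φ (s.piecewise (fun l => stdTensorBasis m (e l, 1))
      (fun l => stdTensorBasis m (e l, 0))) = basisValue φ (fun l => (e l, u s l)) := by
    rw [basisValue]
    congr 1
    ext l : 1
    simp only [Finset.piecewise, u]
    split_ifs <;> rfl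
  simp only [hexp, hval] at hsum
  rw [← Finset.sum_filter, Finset.sum_const, nsmul_eq_mul] at hsum
  have h4 := hsum.symm.trans hadd
  rcases mul_eq_zero.mp h4 with h5 | h5
  · rw [Nat.cast_eq_zero, Finset.card_eq_zero] at h5
    have : s₀ ∈ Finset.univ.filter fun s : Finset (Fin k) => s.card = s₀.card := by simp
    rw [h5] at this
    simp at this
  · exact hne h5

theorem even_fiberCard (hφ : IsSoSlInvariant φ) {t : Fin k → Fin m × Fin 2}
    (ht : basisValue φ t ≠ 0) (i : Fin m) : Even (fiberCard t i) := by
  by_contra hi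
  rw [Nat.not_even_iff_odd] at hi
  have hodd (j : Fin m) : fiberCard t j = 1 := by
    have h1 := neg_one_pow_fiberCard_eq hφ ht i j
    rw [hi.neg_one_pow] at h1
    have h2 := fiberCard_le_two (injective_of_basisValue_ne_zero ht) j
    interval_cases fiberCard t j
    · norm_num at h1
    · rfl
    · norm_num at h1
  have hbij : Function.Bijective fun l => (t l).1 := by
    rw [Function.bijective_iff_existsUnique]
    intro j
    obtain ⟨l, hl⟩ := Finset.card_eq_one.mp (hodd j)
    have hl' (r : Fin k) : (t r).1 = j ↔ r = l := by
      simpa using Finset.ext_iff.mp hl r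
    exact ⟨l, (hl' l).mpr rfl, fun r hr => (hl' r).mp hr⟩
  have hk : k ≠ 0 := by
    rintro rfl
    obtain ⟨l, -⟩ := hbij.2 i
    exact l.elim0
  exact ht (basisValue_eq_zero_of_bijective hφ hk (Equiv.ofBijective _ hbij) fun l => (t l).2)

theorem exists_image_eq_product (hφ : IsSoSlInvariant φ) {t : Fin k → Fin m × Fin 2}
    (ht : basisValue φ t ≠ 0) :
    ∃ S : Finset (Fin m), Finset.univ.image t = S ×ˢ Finset.univ := by
  refine ⟨Finset.univ.filter fun i => fiberCard t i ≠ 0, ?_⟩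
  have hinj := injective_of_basisValue_ne_zero ht
  ext ⟨i, a⟩
  simp only [Finset.mem_image, Finset.mem_univ, true_and, Finset.mem_product, Finset.mem_filter,
    and_true]
  constructor
  · rintro ⟨l, hl⟩ h0
    rw [fiberCard, Finset.card_eq_zero, Finset.filter_eq_empty_iff] at h0
    exact h0 (Finset.mem_univ l) (by rw [hl])
  · intro h0
    have h2 : fiberCard t i = 2 := by
      have h3 := fiberCard_le_two hinj i
      obtain ⟨r, hr⟩ := even_fiberCard hφ ht i
      omega
    have himg : (Finset.univ.filter fun l => (t l).1 = i).image (fun l => (t l).2) =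
        Finset.univ := by
      refine Finset.eq_univ_of_card _ ?_
      rw [Finset.card_image_of_injOn, Fintype.card_fin]
      · exact h2
      · intro l hl l' hl' h
        simp only [Finset.mem_coe, Finset.mem_filter, Finset.mem_univ, true_and] at hl hl'
        exact hinj (Prod.ext (hl.trans hl'.symm) h)
    have hmem : a ∈ (Finset.univ.filter fun l => (t l).1 = i).image (fun l => (t l).2) := by
      rw [himg]; exact Finset.mem_univ a
    obtain ⟨l, hl, hla⟩ := Finset.mem_image.mp hmem
    exact ⟨l, Prod.ext (Finset.mem_filter.mp hl).2 hla⟩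

theorem card_eq_of_image_eq_product {t : Fin k → Fin m × Fin 2} (ht : Function.Injective t)
    {S : Finset (Fin m)} (hS : Finset.univ.image t = S ×ˢ Finset.univ) : k = S.card * 2 := by
  have h := congrArg Finset.card hS
  rwa [Finset.card_image_of_injective _ ht, Finset.card_product, Finset.card_univ,
    Finset.card_univ, Fintype.card_fin, Fintype.card_fin] at h

theorem basisValue_eq_zero_of_basisValue_eq_zero (hφ : IsSoSlInvariant φ)
    {t t' : Fin k → Fin m × Fin 2} (hinj : Function.Injective t) {S : Finset (Fin m)}
    (hS : Finset.univ.image t = S ×ˢ Finset.univ) (h0 : basisValue φ t = 0) :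
    basisValue φ t' = 0 := by
  by_contra hne
  obtain ⟨S', hS'⟩ := exists_image_eq_product hφ hne
  have hinj' := injective_of_basisValue_ne_zero hne
  have hcard : S'.card = S.card := by
    have := card_eq_of_image_eq_product hinj hS
    have := card_eq_of_image_eq_product hinj' hS'
    omega
  obtain ⟨σ, hσ⟩ : ∃ σ : Equiv.Perm (Fin m), ∀ i, i ∈ S' ↔ σ i ∈ S :=
    exists_perm_mem_iff_of_card_eq hcard
  have h1 := basisValue_perm hφ 1 1 (fun _ _ _ => rfl) σ t'
    (fun i => (even_fiberCard hφ hne i).neg_one_pow)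
  rw [MonoidHom.one_apply, one_mul] at h1
  let t₁ : Fin k → Fin m × Fin 2 := fun l => (σ (t' l).1, (t' l).2)
  have hinj₁ : Function.Injective t₁ := by
    intro l l' h
    simp only [t₁, Prod.mk.injEq, EmbeddingLike.apply_eq_iff_eq] at h
    exact hinj' (Prod.ext h.1 h.2)
  have hmem (l : Fin k) : ∃ r, t r = t₁ l := by
    have h2 : t' l ∈ Finset.univ.image t' := Finset.mem_image_of_mem _ (Finset.mem_univ l)
    have h3 : t₁ l ∈ Finset.univ.image t := by
      rw [hS'] at h2
      rw [hS]
      simp only [Finset.mem_product, Finset.mem_univ, and_true, t₁] at h2 ⊢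
      exact (hσ _).mp h2
    simpa using h3
  choose τ hτ using hmem
  have hτinj : Function.Injective τ := fun l l' h => hinj₁ (by rw [← hτ, ← hτ, h])
  have h4 := basisValue_comp_perm φ t
    (Equiv.ofBijective τ (Finite.injective_iff_bijective.mp hτinj))
  rw [h0, mul_zero] at h4
  refine hne (h1.symm.trans (Eq.trans ?_ h4))
  congr 1
  ext l : 1
  exact (hτ l).symm

end Invariant

/-- For `m ≥ 3` and the action of `SO(m,ℂ) × SL(2,ℂ)` on `ℂ^m ⊗ ℂ²`
given by `(A,B)·(v⊗w) = (Av)⊗(Bw)`, the space of invariant elements of `⋀^k (ℂ^m ⊗ ℂ²)`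
has dimension `1` if `k` is even with `0 ≤ k ≤ 2m`, and dimension `0` if `k` is odd. -/
theorem so_sl2_invariants_exterior_power (m : ℕ) (hm : 3 ≤ m) (k : ℕ) :
    Module.finrank ℂ
        ↥(Subalgebra.toSubmodule (soSlInvAlg m) ⊓ (⋀[ℂ]^k (TensorRep m))) =
      if Even k ∧ k ≤ 2 * m then 1 else 0 := by
  have hinv (x : ↥(Subalgebra.toSubmodule (soSlInvAlg m) ⊓ (⋀[ℂ]^k (TensorRep m)))) :
      IsSoSlInvariant (pairingForm ⟨x.1, x.2.2⟩) :=
    isSoSlInvariant_pairingForm (x := ⟨x.1, x.2.2⟩) x.2.1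
  have hzero {x : ↥(Subalgebra.toSubmodule (soSlInvAlg m) ⊓ (⋀[ℂ]^k (TensorRep m)))}
      (hx : ∀ t, basisValue (pairingForm ⟨x.1, x.2.2⟩) t = 0) : x = 0 := by
    have h := eq_zero_of_pairingForm (x := ⟨x.1, x.2.2⟩) hx
    rw [Submodule.mk_eq_zero] at h
    exact Subtype.ext h
  split_ifs with hk
  · obtain ⟨⟨j, rfl⟩, hjm⟩ := hk
    rw [← two_mul] at *
    let y : ↥(Subalgebra.toSubmodule (soSlInvAlg m) ⊓ (⋀[ℂ]^(2 * j) (TensorRep m))) :=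
      ⟨quadInv m ^ j, pow_mem (quadInv_mem m) j, quadInv_pow_mem_exteriorPower m j⟩
    have hy : y ≠ 0 := fun h =>
      quadInv_pow_ne_zero (by omega : j ≤ m) (congrArg Subtype.val h)
    refine (finrank_eq_one_iff_of_nonzero' y hy).mpr fun x => ?_
    obtain ⟨t, ht⟩ : ∃ t, basisValue (pairingForm ⟨y.1, y.2.2⟩) t ≠ 0 := by
      by_contra! h
      exact hy (hzero h)
    obtain ⟨S, hS⟩ := exists_image_eq_product (hinv y) ht
    let c : ℂ := basisValue (pairingForm ⟨x.1, x.2.2⟩) t / basisValue (pairingForm ⟨y.1, y.2.2⟩) t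
    refine ⟨c, (sub_eq_zero.mp (hzero fun t' => ?_)).symm⟩
    refine basisValue_eq_zero_of_basisValue_eq_zero (hinv _)
      (injective_of_basisValue_ne_zero ht) hS ?_
    have h := (pairingForm_sub ⟨x.1, x.2.2⟩ (c • ⟨y.1, y.2.2⟩)
      fun l => stdTensorBasis m (t l)).trans
        (congrArg _ (pairingForm_smul c ⟨y.1, y.2.2⟩ fun l => stdTensorBasis m (t l)))
    exact h.trans (sub_eq_zero.mpr (div_mul_cancel₀ _ ht).symm)
  · suffices h : ∀ x : ↥(Subalgebra.toSubmodule (soSlInvAlg m) ⊓ (⋀[ℂ]^k (TensorRep m))),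
        x = 0 by
      have : Subsingleton ↥(Subalgebra.toSubmodule (soSlInvAlg m) ⊓ (⋀[ℂ]^k (TensorRep m))) :=
        ⟨fun a b => (h a).trans (h b).symm⟩
      exact Module.finrank_zero_of_subsingleton
    refine fun x => hzero fun t => ?_
    by_contra ht
    obtain ⟨S, hS⟩ := exists_image_eq_product (hinv x) ht
    have hcard := card_eq_of_image_eq_product (injective_of_basisValue_ne_zero ht) hS
    have hle := S.card_le_univ
    rw [Fintype.card_fin] at hle
    exact hk ⟨⟨S.card, by omega⟩, by omega⟩
end
end

section
/- Let m ≥ 1 and let Sp(2m, ℂ) act diagonally on W := ℂ^{2m} ⊕ ℂ^{2m} (the direct sum of two copies of the standard representation), with the induced action on the exterior algebra ⋀• W. Then the subalgebra of Sp(2m, ℂ)-invariant elements of ⋀• W is generated, as a unital ℂ-algebra, by its elements of exterior degree 2; explicitly, it is generated by the three invariant 2-forms ω₁ := Σ_{i=1}^{m}(e_i, 0)∧(e_{m+i}, 0), ω₂ := Σ_{i=1}^{m}(0, e_i)∧(0, e_{m+i}), and τ := Σ_{i=1}^{m}( (e_i, 0)∧(0, e_{m+i}) − (e_{m+i}, 0)∧(0,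 e_i) ). (This is the algebraic content of the statement that the invariant differential forms on the 3-Sasakian round sphere S^{4n−1} = Sp(n)/Sp(n−1) are spanned by wedge products of the invariant 1- and 2-forms η_i, Φ_i|_H.) -/
noncomputable section

/-- `ℂ^{2m}`, with the basis indexed by `Fin m ⊕ Fin m` (so `e_i = inl i` and
`e_{m+i} = inr i`). -/
abbrev Cn2 (m : ℕ) : Type := (Fin m ⊕ Fin m) → ℂ

/-- The matrix `J` of the standard symplectic form
`Ω(x,y) = ∑_{i=1}^m (x_i y_{m+i} - x_{m+i} y_i)`, i.e. `Ω(x,y) = xᵀ J y`. -/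
def Jstd (m : ℕ) : Matrix (Fin m ⊕ Fin m) (Fin m ⊕ Fin m) ℂ :=
  Matrix.fromBlocks 0 1 (-1) 0

/-- Membership in the symplectic group `Sp(2m, ℂ) = {g : gᵀ J g = J}`. -/
def IsSymp (m : ℕ) (g : Matrix (Fin m ⊕ Fin m) (Fin m ⊕ Fin m) ℂ) : Prop :=
  g.transpose * Jstd m * g = Jstd m

/-- `W = ℂ^{2m} ⊕ ℂ^{2m}` (two copies of the standard representation). -/
abbrev Wdiag (m : ℕ) : Type := Cn2 m × Cn2 m

/-- The subalgebra of elements of `⋀• W` invariant under the diagonal action of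
`Sp(2m,ℂ)` on `W = ℂ^{2m} ⊕ ℂ^{2m}`. -/
def diagSympInvAlg (m : ℕ) : Subalgebra ℂ (ExteriorAlgebra ℂ (Wdiag m)) where
  carrier := {x | ∀ g, IsSymp m g →
    ExteriorAlgebra.map (LinearMap.prodMap g.mulVecLin g.mulVecLin) x = x}
  mul_mem' := fun hx hy => fun g hg => by rw [map_mul, hx g hg, hy g hg]
  one_mem' := fun g hg => by rw [map_one]
  add_mem' := fun hx hy => fun g hg => by rw [map_add, hx g hg, hy g hg]
  zero_mem' := fun g hg => by rw [map_zero]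
  algebraMap_mem' := fun r => fun g hg => by rw [AlgHom.commutes]

/-- The invariant 2-form `ω₁ = ∑_i (e_i,0) ∧ (e_{m+i},0)`. -/
def omega₁ (m : ℕ) : ExteriorAlgebra ℂ (Wdiag m) :=
  ∑ i : Fin m,
    ExteriorAlgebra.ι ℂ ((Pi.single (Sum.inl i) (1 : ℂ), 0) : Wdiag m) *
      ExteriorAlgebra.ι ℂ ((Pi.single (Sum.inr i) (1 : ℂ), 0) : Wdiag m)

/-- The invariant 2-form `ω₂ = ∑_i (0,e_i) ∧ (0,e_{m+i})`. -/
def omega₂ (m : ℕ) : ExteriorAlgebra ℂ (Wdiag m) :=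
  ∑ i : Fin m,
    ExteriorAlgebra.ι ℂ ((0, Pi.single (Sum.inl i) (1 : ℂ)) : Wdiag m) *
      ExteriorAlgebra.ι ℂ ((0, Pi.single (Sum.inr i) (1 : ℂ)) : Wdiag m)

/-- The invariant 2-form `τ = ∑_i ((e_i,0) ∧ (0,e_{m+i}) - (e_{m+i},0) ∧ (0,e_i))`. -/
def tauForm (m : ℕ) : ExteriorAlgebra ℂ (Wdiag m) :=
  ∑ i : Fin m,
    (ExteriorAlgebra.ι ℂ ((Pi.single (Sum.inl i) (1 : ℂ), 0) : Wdiag m) *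
        ExteriorAlgebra.ι ℂ ((0, Pi.single (Sum.inr i) (1 : ℂ)) : Wdiag m) -
      ExteriorAlgebra.ι ℂ ((Pi.single (Sum.inr i) (1 : ℂ), 0) : Wdiag m) *
        ExteriorAlgebra.ι ℂ ((0, Pi.single (Sum.inl i) (1 : ℂ)) : Wdiag m))

section CAR

variable {R : Type*} [Ring R] {S I : Type*} [DecidableEq S] [DecidableEq I]

theorem lie_mul_eq (x y z : R) : ⁅x, y * z⁆ = ⁅x, y⁆ * z + y * ⁅x, z⁆ := by
  simp only [Ring.lie_def]; noncomm_ring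

theorem ring_lie_sum {κ : Type*} (s : Finset κ) (x : R) (f : κ → R) :
    ⁅x, ∑ i ∈ s, f i⁆ = ∑ i ∈ s, ⁅x, f i⁆ := by
  simp only [Ring.lie_def, Finset.mul_sum, Finset.sum_mul, Finset.sum_sub_distrib]

theorem ring_sum_lie {κ : Type*} (s : Finset κ) (x : R) (f : κ → R) :
    ⁅∑ i ∈ s, f i, x⁆ = ∑ i ∈ s, ⁅f i, x⁆ := by
  simp only [Ring.lie_def, Finset.mul_sum, Finset.sum_mul, Finset.sum_sub_distrib]

theorem ring_sub_lie (x y z : R) : ⁅x - y, z⁆ = ⁅x, z⁆ - ⁅y, z⁆ := by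
  simp only [Ring.lie_def]; noncomm_ring

theorem algebra_smul_lie [Algebra ℂ R] (r : ℂ) (x y : R) : ⁅r • x, y⁆ = r • ⁅x, y⁆ := by
  simp only [Ring.lie_def, smul_mul_assoc, mul_smul_comm, smul_sub]

theorem algebra_lie_smul [Algebra ℂ R] (r : ℂ) (x y : R) : ⁅x, r • y⁆ = r • ⁅x, y⁆ := by
  simp only [Ring.lie_def, smul_mul_assoc, mul_smul_comm, smul_sub]

/-- The canonical anticommutation relations between creation operators `c` and annihilation
operators `a`. -/
structure IsCAR (c a : S → I → R) : Prop where
  cc : ∀ s i t j, c s i * c t j = -(c t j * c s i)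
  aa : ∀ s i t j, a s i * a t j = -(a t j * a s i)
  ac : ∀ s i t j, a s i * c t j = (if s = t ∧ i = j then 1 else 0) - c t j * a s i

namespace IsCAR

variable {c a : S → I → R} (h : IsCAR c a)
include h

theorem lie_mul_c (s i t j u k) :
    ⁅c s i * a t j, c u k⁆ = if t = u ∧ j = k then c s i else 0 := by
  rw [Ring.lie_def, mul_assoc, h.ac, ← mul_assoc, h.cc u k s i]
  split_ifs <;> noncomm_ring

theorem lie_mul_a (s i t j u k) :
    ⁅c s i * a t j, a u k⁆ = if u = s ∧ k = i then -a t j else 0 := by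
  rw [Ring.lie_def, mul_assoc, h.aa t j u k, ← mul_assoc, h.ac]
  split_ifs <;> noncomm_ring

end IsCAR

/-- The signs occurring in the standard symplectic form. -/
def spSign {ι : Type*} : ι ⊕ ι → ℂ := Sum.elim (fun _ => 1) (fun _ => -1)

theorem spSign_swap {ι : Type*} (i : ι ⊕ ι) : spSign i.swap = -spSign i := by
  cases i <;> simp [spSign]

theorem spSign_mul_self {ι : Type*} (i : ι ⊕ ι) : spSign i * spSign i = 1 := by
  cases i <;> simp [spSign]

theorem sum_swap_eq_iff {ι : Type*} (i j : ι ⊕ ι) : i.swap = j ↔ i = j.swap := by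
  cases i <;> cases j <;> simp

end CAR

section Ops
variable {R : Type*} [Ring R] [Algebra ℂ R] {S ι : Type*} [Fintype ι]

/-- The polarization operators. -/
def polar (c a : S → ι ⊕ ι → R) (s t : S) : R := ∑ i, c s i * a t i

/-- The contraction of the copies `s` and `t` with the symplectic form. -/
def spPair (c : S → ι ⊕ ι → R) (s t : S) : R := ∑ i, spSign i • (c s i * c t i.swap)

/-- The operators by which the symplectic Lie algebra acts. -/
def spLie [Fintype S] (c a : S → ι ⊕ ι → R) (i j : ι ⊕ ι) : R :=
  ∑ s, (c s i * a s j - (spSign i * spSign j) • (c s j.swap * a s i.swap))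

namespace IsCAR
variable [DecidableEq S] [DecidableEq ι] {c a : S → ι ⊕ ι → R} (h : IsCAR c a)
include h

theorem lie_polar_c (s t u k) : ⁅polar c a s t, c u k⁆ = if t = u then c s k else 0 := by
  simp only [polar, ring_sum_lie, h.lie_mul_c, ite_and]
  split_ifs <;> simp

theorem lie_polar_a (s t u k) : ⁅polar c a s t, a u k⁆ = if s = u then -a t k else 0 := by
  simp only [polar, ring_sum_lie, h.lie_mul_a, ite_and, eq_comm (a := u)]
  split_ifs <;> simp

theorem lie_spLie_c [Fintype S] (i j u k) : ⁅spLie c a i j, c u k⁆ =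
    (if j = k then c u i else 0) -
      (spSign i * spSign j) • (if i.swap = k then c u j.swap else 0) := by
  simp only [spLie, ring_sum_lie, ring_sub_lie, algebra_smul_lie, h.lie_mul_c, Finset.sum_sub_distrib, ite_and,
    ← Finset.smul_sum, Finset.sum_ite_eq', Finset.mem_univ, if_true]

theorem lie_spLie_a [Fintype S] (i j u k) : ⁅spLie c a i j, a u k⁆ =
    (if k = i then -a u j else 0) -
      (spSign i * spSign j) • (if k = j.swap then -a u i.swap else 0) := by
  simp only [spLie, ring_sum_lie, ring_sub_lie, algebra_smul_lie, h.lie_mul_a, Finset.sum_sub_distrib, ite_and,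
    ← Finset.smul_sum, Finset.sum_ite_eq, Finset.mem_univ, if_true]

theorem lie_polar_polar (s t u v) : ⁅polar c a s t, polar c a u v⁆ =
    (if t = u then polar c a s v else 0) - (if s = v then polar c a u t else 0) := by
  conv_lhs => rw [polar.eq_def c a u v]
  simp only [ring_lie_sum, lie_mul_eq, h.lie_polar_c, h.lie_polar_a, Finset.sum_add_distrib]
  split_ifs <;> simp [polar, sub_eq_add_neg, -Fintype.sum_sum_type]

theorem lie_polar_pair_c (s t u v) : ⁅polar c a s t, spPair c u v⁆ =
    (if t = u then spPair c s v else 0) + (if t = v then spPair c u s else 0) := by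
  simp only [spPair, ring_lie_sum, algebra_lie_smul, lie_mul_eq, h.lie_polar_c, smul_add,
    Finset.sum_add_distrib]
  split_ifs <;> simp

theorem lie_polar_pair_a (s t u v) : ⁅polar c a s t, spPair a u v⁆ =
    (if s = u then -spPair a t v else 0) + (if s = v then -spPair a u t else 0) := by
  simp only [spPair, ring_lie_sum, algebra_lie_smul, lie_mul_eq, h.lie_polar_a, smul_add,
    Finset.sum_add_distrib]
  split_ifs <;> simp

theorem lie_spLie_polar [Fintype S] (i j s t) : ⁅spLie c a i j, polar c a s t⁆ = 0 := by
  simp only [polar, ring_lie_sum, lie_mul_eq, h.lie_spLie_c, h.lie_spLie_a, Finset.sum_add_distrib,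
    sub_mul, mul_sub, Finset.sum_sub_distrib, smul_mul_assoc, mul_smul_comm, ← Finset.smul_sum,
    ite_mul, mul_ite, zero_mul, mul_zero, Finset.sum_ite_eq, Finset.sum_ite_eq', Finset.mem_univ,
    if_true]
  simp only [mul_neg, smul_neg]
  abel

theorem lie_spLie_pair_a [Fintype S] (i j s t) : ⁅spLie c a i j, spPair a s t⁆ = 0 := by
  simp only [spPair, ring_lie_sum, algebra_lie_smul, lie_mul_eq, h.lie_spLie_a, Finset.sum_add_distrib,
    sub_mul, mul_sub, Finset.sum_sub_distrib, smul_mul_assoc, mul_smul_comm, smul_add, smul_sub,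
    ite_mul, mul_ite, zero_mul, mul_zero, sum_swap_eq_iff, smul_ite, smul_zero, Sum.swap_swap]
  simp only [Finset.sum_ite_eq', Finset.mem_univ, if_true, spSign_swap, smul_smul, Sum.swap_swap]
  have h1 := spSign_mul_self i
  have h2 := spSign_mul_self j
  have e : spSign j * (spSign i * spSign j) = spSign i := by linear_combination spSign i * h2
  have e' : -spSign j * (spSign i * spSign j) = -spSign i := by linear_combination -spSign i * h2
  rw [e, e']
  simp only [neg_mul, mul_neg, smul_neg, neg_smul]
  abel

theorem sum_quad_one (s t : S) :
    ∑ i, ∑ j, c t j * a t i * (c s i * a s j) =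
      (if t = s then (2 * Fintype.card ι : ℂ) • polar c a t t else 0) + polar c a t t
        - polar c a t s * polar c a s t := by
  have key : ∀ i j, c t j * a t i * (c s i * a s j) =
      (if t = s then c t j * a s j else 0) + (if i = j then c t j * a t i else 0)
        - (c t j * a s j) * (c s i * a t i) := by
    intro i j
    have h1 : c t j * a t i * (c s i * a s j) = c t j * (a t i * c s i) * a s j := by
      noncomm_ring
    have h2 : (c t j * a s j) * (c s i * a t i) = c t j * (a s j * c s i) * a t i := by
      noncomm_ring
    have h3 : c t j * (c s i * a t i) * a s j = -(c t j * (c s i * a s j) * a t i) := by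
      have := h.aa t i s j
      rw [← mul_assoc, mul_assoc _ (a t i), this]; noncomm_ring
    rw [h1, h2, h.ac, h.ac]
    simp only [eq_comm (a := j) (b := i)]
    simp only [mul_sub, sub_mul, h3]
    by_cases hts : t = s
    · subst hts
      by_cases hij : i = j <;> simp [hij]
    · by_cases hij : i = j <;> simp [hij, hts]
  simp only [key, Finset.sum_sub_distrib, Finset.sum_add_distrib]
  congr 1
  · congr 1
    · split_ifs with hts
      · subst hts
        simp [polar, two_mul, ← Nat.cast_smul_eq_nsmul ℂ]
      · simp
    · simp [polar]
  · rw [Finset.sum_comm]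
    simp only [polar, Finset.sum_mul_sum]

theorem sum_quad_two (s t : S) :
    ∑ i, ∑ j, c t j * a t i * ((spSign i * spSign j) • (c s j.swap * a s i.swap)) =
      -(if t = s then polar c a t t else 0) - spPair c t s * spPair a t s := by
  have key : ∀ i j, c t j * a t i * ((spSign i * spSign j) • (c s j.swap * a s i.swap)) =
      (if i = j.swap then (if t = s then -(c t j * a s j) else 0) else 0)
        - (spSign j • (c t j * c s j.swap)) * (spSign i • (a t i * a s i.swap)) := by
    intro i j
    have h1 : c t j * a t i * (c s j.swap * a s i.swap)
        = c t j * (a t i * c s j.swap) * a s i.swap := by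
      noncomm_ring
    have hj := spSign_mul_self j
    rw [mul_smul_comm, h1, h.ac, smul_mul_smul_comm, mul_comm (spSign j)]
    simp only [mul_sub, sub_mul, smul_sub, mul_assoc]
    congr 1
    by_cases hij : i = j.swap
    · subst hij
      by_cases hts : t = s <;> simp [hts, spSign_swap, hj]
    · simp [hij]
  simp only [key, Finset.sum_sub_distrib]
  congr 1
  · rw [Finset.sum_comm]
    simp only [Finset.sum_ite_eq', Finset.mem_univ, if_true]
    split_ifs with hts
    · subst hts; simp [polar]
    · simp
  · rw [Finset.sum_comm]
    simp only [spPair, Finset.sum_mul_sum]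

/-- A Capelli-type identity. -/
theorem capelli [Fintype S] (t : S) :
    ∑ i, ∑ j, c t j * a t i * spLie c a i j =
      (2 * Fintype.card ι + Fintype.card S + 1 : ℂ) • polar c a t t
        - ∑ s, polar c a t s * polar c a s t + ∑ s, spPair c t s * spPair a t s := by
  have e : ∑ i, ∑ j, c t j * a t i * spLie c a i j =
      ∑ s, (∑ i, ∑ j, c t j * a t i * (c s i * a s j) -
        ∑ i, ∑ j, c t j * a t i * ((spSign i * spSign j) • (c s j.swap * a s i.swap))) := by
    simp only [spLie, Finset.mul_sum, mul_sub, ← Finset.sum_sub_distrib]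
    exact (Finset.sum_congr rfl fun i _ => Finset.sum_comm).trans Finset.sum_comm
  rw [e]
  simp only [h.sum_quad_one, h.sum_quad_two, Finset.sum_sub_distrib, Finset.sum_add_distrib,
    Finset.sum_neg_distrib, Finset.sum_ite_eq, Finset.mem_univ, if_true, Finset.sum_const,
    Finset.card_univ, add_smul, ← Nat.cast_smul_eq_nsmul ℂ, one_smul]
  abel

end IsCAR
end Ops

theorem le_iSup_inf_eigenspace {K V : Type*} [Field K] [DecidableEq K] [AddCommGroup V] [Module K V]
    (f : Module.End K V) (s : Finset K)
    (hf : Polynomial.aeval f (∏ k ∈ s, (Polynomial.X - Polynomial.C k)) = 0)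
    (p : Submodule K V) (hp : ∀ x ∈ p, f x ∈ p) :
    p ≤ ⨆ k ∈ s, p ⊓ f.eigenspace k := by
  intro x hx
  rcases s.eq_empty_or_nonempty with rfl | hs
  · have : x = 0 := by simpa using LinearMap.congr_fun hf x
    simp [this]
  have h1 : x = ∑ k ∈ s, Polynomial.aeval f (Lagrange.basis s id k) x := by
    rw [← LinearMap.sum_apply, ← map_sum, Lagrange.sum_basis Function.injective_id.injOn hs]
    simp
  have hinv : ∀ q : Polynomial K, Polynomial.aeval f q x ∈ p := by
    intro q
    induction q using Polynomial.induction_on' with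
    | add q r hq hr => simpa using p.add_mem hq hr
    | monomial n r =>
      rw [Polynomial.aeval_monomial, Module.End.mul_apply, Module.algebraMap_end_apply]
      refine p.smul_mem _ ?_
      induction n with
      | zero => simpa
      | succ n ih => rw [pow_succ', Module.End.mul_apply]; exact hp _ ih
  rw [h1]
  refine Submodule.sum_mem _ fun k hk => ?_
  refine Submodule.mem_iSup_of_mem k (Submodule.mem_iSup_of_mem hk ⟨hinv _, ?_⟩)
  rw [SetLike.mem_coe, Module.End.mem_eigenspace_iff]
  have h2 : (Polynomial.X - Polynomial.C k) * Lagrange.basis s id k =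
      Polynomial.C (∏ j ∈ s.erase k, (k - j)⁻¹) * ∏ k ∈ s, (Polynomial.X - Polynomial.C k) := by
    rw [← Finset.mul_prod_erase s _ hk, Lagrange.basis]
    simp only [Lagrange.basisDivisor, Finset.prod_mul_distrib, map_prod, id]
    ring
  have h3 := congrArg (fun q => Polynomial.aeval f q x) h2
  simp only [map_mul, hf, map_sub, Polynomial.aeval_X, Polynomial.aeval_C, mul_zero,
    LinearMap.zero_apply, Module.End.mul_apply, LinearMap.sub_apply,
    Module.algebraMap_end_apply] at h3
  exact sub_eq_zero.mp h3

section Fock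
variable {K M : Type*} [CommRing K] [AddCommGroup M] [Module K M]

/-- Left multiplication by the vector `v` on the exterior algebra. -/
def creation (v : M) : Module.End K (ExteriorAlgebra K M) :=
  LinearMap.mulLeft K (ExteriorAlgebra.ι K v)

/-- Contraction by the linear form `d` on the exterior algebra. -/
def annihilation (d : Module.Dual K M) : Module.End K (ExteriorAlgebra K M) :=
  CliffordAlgebra.contractLeft (Q := (0 : QuadraticForm K M)) d

theorem creation_apply (v : M) (x : ExteriorAlgebra K M) :
    creation v x = ExteriorAlgebra.ι K v * x := rfl

theorem annihilation_one (d : Module.Dual K M) :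
    annihilation d (1 : ExteriorAlgebra K M) = 0 :=
  CliffordAlgebra.contractLeft_one _ d

theorem creation_add (v w : M) : creation (K := K) (v + w) = creation v + creation w := by
  refine LinearMap.ext fun x => ?_
  simp [creation_apply, add_mul]

theorem creation_smul (r : K) (v : M) : creation (K := K) (r • v) = r • creation v := by
  refine LinearMap.ext fun x => ?_
  simp [creation_apply]

theorem annihilation_add (d e : Module.Dual K M) :
    annihilation (d + e) = annihilation d + annihilation e := map_add _ _ _

theorem annihilation_smul (r : K) (d : Module.Dual K M) :
    annihilation (r • d) = r • annihilation d := map_smul _ _ _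

theorem creation_mul_self (v : M) : creation (K := K) v * creation v = 0 := by
  refine LinearMap.ext fun x => ?_
  simp [creation_apply, ← mul_assoc]

theorem creation_mul_creation (v w : M) :
    creation (K := K) v * creation w = -(creation w * creation v) := by
  refine LinearMap.ext fun x => ?_
  have h := ExteriorAlgebra.ι_add_mul_swap (R := K) v w
  rw [LinearMap.neg_apply, eq_neg_iff_add_eq_zero]
  simp only [creation_apply, Module.End.mul_apply, ← mul_assoc, ← add_mul, h, zero_mul]

theorem annihilation_mul_annihilation (d e : Module.Dual K M) :
    annihilation d * annihilation e = -(annihilation e * annihilation d) := by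
  refine LinearMap.ext fun x => ?_
  exact CliffordAlgebra.contractLeft_comm _ _ _

theorem annihilation_mul_creation (d : Module.Dual K M) (v : M) :
    annihilation d * creation v = d v • 1 - creation v * annihilation d := by
  refine LinearMap.ext fun x => ?_
  exact CliffordAlgebra.contractLeft_ι_mul _ _ _

theorem transvection_mul {R : Type*} [Ring R] [Algebra K R] {v₁ v₂ a₁ a₂ w : R} {r₁ r₂ : K}
    (h₁ : a₁ * w = r₁ • 1 - w * a₁) (h₂ : a₂ * w = r₂ • 1 - w * a₂)
    (hv₁ : v₁ * v₁ = 0) (hv₂ : v₂ * v₂ = 0) (hw₁ : v₁ * w = -(w * v₁)) (hw₂ : v₂ * w = -(w * v₂))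
    (hv : v₁ * v₂ = -(v₂ * v₁)) (ha : a₁ * v₂ = (0 : K) • 1 - v₂ * a₁) :
    (w + r₁ • v₁ + r₂ • v₂) * (1 + (v₁ * a₁ + v₂ * a₂) + v₁ * a₁ * (v₂ * a₂)) =
      (1 + (v₁ * a₁ + v₂ * a₂) + v₁ * a₁ * (v₂ * a₂)) * w := by
  have k1 : v₁ * a₁ * w = w * (v₁ * a₁) + r₁ • v₁ := by
    rw [mul_assoc, h₁, mul_sub, ← mul_assoc, hw₁, mul_smul_comm, mul_one]
    noncomm_ring
  have k2 : v₂ * a₂ * w = w * (v₂ * a₂) + r₂ • v₂ := by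
    rw [mul_assoc, h₂, mul_sub, ← mul_assoc, hw₂, mul_smul_comm, mul_one]
    noncomm_ring
  have c12 : v₁ * a₁ * v₂ = v₂ * (v₁ * a₁) := by
    rw [mul_assoc, ha, zero_smul, zero_sub, mul_neg, ← mul_assoc, hv]
    noncomm_ring
  have s1 : v₁ * (v₁ * a₁) = 0 := by rw [← mul_assoc, hv₁, zero_mul]
  have s2 : v₂ * (v₂ * a₂) = 0 := by rw [← mul_assoc, hv₂, zero_mul]
  generalize v₁ * a₁ = n₁ at *
  generalize v₂ * a₂ = n₂ at *
  have s3 : v₂ * (n₁ * n₂) = 0 := by rw [← mul_assoc, ← c12, mul_assoc, s2, mul_zero]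
  have s4 : v₁ * (n₁ * n₂) = 0 := by rw [← mul_assoc, s1, zero_mul]
  have k3 : n₁ * n₂ * w = w * (n₁ * n₂) + r₁ • (v₁ * n₂) + r₂ • (v₂ * n₁) := by
    rw [mul_assoc, k2, mul_add, ← mul_assoc, k1, mul_smul_comm, c12, add_mul, smul_mul_assoc,
      mul_assoc]
  simp only [add_mul, mul_add, one_mul, mul_one, k1, k2, k3, smul_mul_assoc, s1, s2, s3, s4,
    smul_zero]
  abel

set_option maxHeartbeats 2000000 in
theorem eq_transvection_of_mul {V : Type*} [AddCommGroup V] [Module K V]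
    (c : M → Module.End K V) (a : Module.Dual K M → Module.End K V)
    (c_add : ∀ v w, c (v + w) = c v + c w) (c_smul : ∀ (r : K) v, c (r • v) = r • c v)
    (cc_self : ∀ v, c v * c v = 0) (cc : ∀ v w, c v * c w = -(c w * c v))
    (ac : ∀ d v, a d * c v = d v • 1 - c v * a d)
    (vac : V) (hvac : ∀ d, a d vac = 0)
    (hspan : ∀ p : Submodule K V, vac ∈ p → (∀ w, ∀ x ∈ p, c w x ∈ p) → p = ⊤)
    (v₁ v₂ : M) (d₁ d₂ : Module.Dual K M) (h₁₂ : d₁ v₂ = 0)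
    (g : M →ₗ[K] M) (hg : ∀ w, g w = w + d₁ w • v₁ + d₂ w • v₂)
    (G : Module.End K V) (hG : ∀ w x, G (c w x) = c (g w) (G x)) (hG' : G vac = vac) :
    G = 1 + (c v₁ * a d₁ + c v₂ * a d₂) + c v₁ * a d₁ * (c v₂ * a d₂) := by
  refine LinearMap.ext fun x => ?_
  have := hspan (LinearMap.eqLocus G
    (1 + (c v₁ * a d₁ + c v₂ * a d₂) + c v₁ * a d₁ * (c v₂ * a d₂))) ?_ ?_
  · exact (this ▸ Submodule.mem_top : x ∈ LinearMap.eqLocus G _)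
  · rw [LinearMap.mem_eqLocus, hG']
    simp [hvac]
  · intro w y hy
    rw [LinearMap.mem_eqLocus] at hy ⊢
    rw [hG, hy, hg, c_add, c_add, c_smul, c_smul, ← Module.End.mul_apply, ← Module.End.mul_apply]
    refine congrArg (fun T : Module.End K V => T y) ?_
    exact transvection_mul (ac _ _) (ac _ _) (cc_self _) (cc_self _) (cc _ _) (cc _ _) (cc _ _)
      (by rw [ac, h₁₂])

theorem derivation_eq_zero_of_transvection [Invertible (2 : K)]
    {V : Type*} [AddCommGroup V] [Module K V]
    (c : M → Module.End K V) (a : Module.Dual K M → Module.End K V)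
    (c_add : ∀ v w, c (v + w) = c v + c w) (c_smul : ∀ (r : K) v, c (r • v) = r • c v)
    (cc_self : ∀ v, c v * c v = 0) (cc : ∀ v w, c v * c w = -(c w * c v))
    (ac : ∀ d v, a d * c v = d v • 1 - c v * a d) (a_neg : ∀ d, a (-d) = - a d)
    (vac : V) (hvac : ∀ d, a d vac = 0)
    (hspan : ∀ p : Submodule K V, vac ∈ p → (∀ w, ∀ x ∈ p, c w x ∈ p) → p = ⊤)
    (v₁ v₂ : M) (d₁ d₂ : Module.Dual K M) (h₁₂ : d₁ v₂ = 0)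
    (g g' : M →ₗ[K] M) (hg : ∀ w, g w = w + d₁ w • v₁ + d₂ w • v₂)
    (hg' : ∀ w, g' w = w - d₁ w • v₁ - d₂ w • v₂)
    (G G' : Module.End K V) (hG : ∀ w x, G (c w x) = c (g w) (G x)) (hGv : G vac = vac)
    (hG' : ∀ w x, G' (c w x) = c (g' w) (G' x)) (hGv' : G' vac = vac)
    (x : V) (hx : G x = x) (hx' : G' x = x) :
    c v₁ (a d₁ x) + c v₂ (a d₂ x) = 0 := by
  have e := eq_transvection_of_mul c a c_add c_smul cc_self cc ac vac hvac hspan v₁ v₂ d₁ d₂ h₁₂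
    g hg G hG hGv
  have e' := eq_transvection_of_mul c a c_add c_smul cc_self cc ac vac hvac hspan v₁ v₂ (-d₁) (-d₂)
    (by simp [h₁₂]) g' (fun w => by rw [hg']; simp [sub_eq_add_neg]) G' hG' hGv'
  have f := congrArg (fun T : Module.End K V => T x) e
  have f' := congrArg (fun T : Module.End K V => T x) e'
  simp only [hx, hx', a_neg, mul_neg, LinearMap.neg_apply, LinearMap.add_apply,
    Module.End.one_apply, Module.End.mul_apply] at f f'
  have h2 : (2 : K) • (c v₁ (a d₁ x) + c v₂ (a d₂ x)) = 0 := by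
    have h := sub_eq_zero.mpr (f.symm.trans f')
    rw [two_smul, ← h]
    abel
  simpa using congrArg (fun z => (⅟2 : K) • z) h2

theorem eq_top_of_creation_mem (p : Submodule K (ExteriorAlgebra K M)) (h1 : 1 ∈ p)
    (hp : ∀ w, ∀ x ∈ p, creation w x ∈ p) : p = ⊤ := by
  refine Submodule.eq_top_iff'.mpr fun x => ?_
  induction x using CliffordAlgebra.left_induction with
  | algebraMap r =>
    rw [Algebra.algebraMap_eq_smul_one]
    exact p.smul_mem r h1
  | add x y hx hy => exact p.add_mem hx hy
  | ι_mul x w hx => exact hp w x hx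

theorem annihilation_neg (d : Module.Dual K M) :
    annihilation (-d) = -annihilation d := map_neg _ _

theorem derivation_eq_zero_of_map_eq [Invertible (2 : K)]
    (v₁ v₂ : M) (d₁ d₂ : Module.Dual K M) (h₁₂ : d₁ v₂ = 0) (g g' : M →ₗ[K] M)
    (hg : ∀ w, g w = w + d₁ w • v₁ + d₂ w • v₂)
    (hg' : ∀ w, g' w = w - d₁ w • v₁ - d₂ w • v₂) (x : ExteriorAlgebra K M)
    (hx : ExteriorAlgebra.map g x = x) (hx' : ExteriorAlgebra.map g' x = x) :
    creation v₁ (annihilation d₁ x) + creation v₂ (annihilation d₂ x) = 0 := by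
  have hG : ∀ (g : M →ₗ[K] M) (w : M) (x : ExteriorAlgebra K M),
      (ExteriorAlgebra.map g).toLinearMap (creation w x) =
        creation (g w) ((ExteriorAlgebra.map g).toLinearMap x) := by
    intro g w x
    simp [creation_apply]
  exact derivation_eq_zero_of_transvection creation annihilation creation_add creation_smul
    creation_mul_self creation_mul_creation annihilation_mul_creation annihilation_neg 1
    annihilation_one eq_top_of_creation_mem v₁ v₂ d₁ d₂ h₁₂ g g' hg hg'
    (ExteriorAlgebra.map g).toLinearMap (ExteriorAlgebra.map g').toLinearMap (hG g)
    (map_one (ExteriorAlgebra.map g)) (hG g') (map_one (ExteriorAlgebra.map g')) x hx hx'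

end Fock

section FockSpace

variable {V : Type*} [AddCommGroup V] [Module ℂ V] {S J : Type*} [DecidableEq S] [DecidableEq J]

/-- Occupation-number vectors: simultaneous eigenvectors of all number operators, with eigenvalues
`0` and `1`, that are vacuum vectors unless some eigenvalue is `1`. -/
structure IsOccupationVector (c a : S → J → Module.End ℂ V) (vac y : V) : Prop where
  number : ∀ s i, c s i (a s i y) = 0 ∨ c s i (a s i y) = y
  occupied : y ∈ Submodule.span ℂ {vac} ∨ ∃ s i, c s i (a s i y) = y

namespace IsCAR
variable {c a : S → J → Module.End ℂ V} (h : IsCAR c a)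
include h

theorem cc_apply (s i t j) (x : V) : c s i (c t j x) = -c t j (c s i x) := by
  simpa using LinearMap.congr_fun (h.cc s i t j) x

theorem ac_apply (s i t j) (x : V) :
    a s i (c t j x) = (if s = t ∧ i = j then x else 0) - c t j (a s i x) := by
  have := LinearMap.congr_fun (h.ac s i t j) x
  split_ifs with hs
  · simpa [hs] using this
  · simpa [hs] using this

theorem cc_self_apply (s i) (x : V) : c s i (c s i x) = 0 := by
  have := h.cc_apply s i s i x
  rw [eq_neg_iff_add_eq_zero, ← two_smul ℂ] at this
  exact (smul_eq_zero.mp this).resolve_left two_ne_zero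

theorem number_apply_c (s i t j) (x : V) :
    c s i (a s i (c t j x)) = (if s = t ∧ i = j then c t j x else 0) + c t j (c s i (a s i x)) := by
  rw [h.ac_apply, map_sub, h.cc_apply s i t j, sub_neg_eq_add]
  split_ifs with hs
  · rw [hs.1, hs.2]
  · rw [map_zero]

theorem isOccupationVector_vac {vac : V} (hvac : ∀ s i, a s i vac = 0) :
    IsOccupationVector c a vac vac where
  number s i := by simp [hvac]
  occupied := Or.inl (Submodule.mem_span_singleton_self _)

theorem isOccupationVector_c {vac y : V} (hy : IsOccupationVector c a vac y) (t : S) (j : J) :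
    IsOccupationVector c a vac (c t j y) := by
  rcases hy.number t j with h0 | h1
  · refine ⟨fun s i => ?_, Or.inr ⟨t, j, ?_⟩⟩
    · rw [h.number_apply_c]
      by_cases hs : s = t ∧ i = j
      · obtain ⟨rfl, rfl⟩ := hs
        simp [h0]
      · rcases hy.number s i with e | e <;> simp [hs, e]
    · simp [h.number_apply_c, h0]
  · have : c t j y = 0 := by rw [← h1, h.cc_self_apply]
    simp only [this]
    exact ⟨fun s i => by simp, Or.inl (Submodule.zero_mem _)⟩

theorem span_isOccupationVector {vac : V} (hvac : ∀ s i, a s i vac = 0)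
    (hspan : ∀ p : Submodule ℂ V, vac ∈ p → (∀ s i, ∀ x ∈ p, c s i x ∈ p) → p = ⊤) :
    Submodule.span ℂ {y | IsOccupationVector c a vac y} = ⊤ := by
  refine hspan _ (Submodule.subset_span (h.isOccupationVector_vac hvac)) fun s i x hx => ?_
  induction hx using Submodule.span_induction with
  | mem x hx => exact Submodule.subset_span (h.isOccupationVector_c hx s i)
  | zero => rw [map_zero]; exact Submodule.zero_mem _
  | add x y _ _ hx hy => rw [map_add]; exact Submodule.add_mem _ hx hy
  | smul r x _ hx => rw [map_smul]; exact Submodule.smul_mem _ r hx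

end IsCAR

variable {ι : Type*} [Fintype ι]

theorem IsOccupationVector.polar_apply {c a : S → ι ⊕ ι → Module.End ℂ V} {vac y : V}
    (hy : IsOccupationVector c a vac y) (s : S) :
    ∃ k : ℕ, k ≤ 2 * Fintype.card ι ∧ polar c a s s y = (k : ℂ) • y ∧
      ((∃ i, c s i (a s i y) = y) → 1 ≤ k) := by
  classical
  refine ⟨(Finset.univ.filter fun i => c s i (a s i y) = y).card, ?_, ?_, ?_⟩
  · refine (Finset.card_le_univ _).trans_eq ?_
    rw [Fintype.card_sum, two_mul]
  · have : ∀ i, c s i (a s i y) = if c s i (a s i y) = y then y else 0 := by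
      intro i
      split_ifs with hi
      · exact hi
      · exact (hy.number s i).resolve_right hi
    rw [polar, LinearMap.sum_apply]
    simp only [Module.End.mul_apply]
    rw [Finset.sum_congr rfl fun i _ => this i, Finset.sum_ite, Finset.sum_const_zero, add_zero,
      Finset.sum_const, Nat.cast_smul_eq_nsmul]
  · rintro ⟨i, hi⟩
    exact Finset.card_pos.mpr ⟨i, by simpa using hi⟩

section Main

open Polynomial

variable [DecidableEq ι] {c a : Fin 2 → ι ⊕ ι → Module.End ℂ V} (h : IsCAR c a) {vac : V}
  (hvac : ∀ s i, a s i vac = 0)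
  (hspan : ∀ p : Submodule ℂ V, vac ∈ p → (∀ s i, ∀ x ∈ p, c s i x ∈ p) → p = ⊤)

include h hvac hspan in
theorem aeval_polar_eq_zero (s : Fin 2) :
    aeval (polar c a s s) (∏ k ∈ (Finset.range (2 * Fintype.card ι + 1)).map Nat.castEmbedding,
      (X - C (k : ℂ))) = 0 := by
  refine LinearMap.ext_on (h.span_isOccupationVector hvac hspan) fun y hy => ?_
  obtain ⟨k, hk, e, -⟩ := IsOccupationVector.polar_apply hy s
  rw [Module.End.aeval_apply_of_mem_apply_eq_smul e, eval_prod, Finset.prod_eq_zero (i := (k : ℂ)),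
    zero_smul, LinearMap.zero_apply]
  · simpa using Nat.lt_succ_of_le hk
  · simp

include h hvac hspan in
theorem polar_eigenvalue_mem {s : Fin 2} {μ : ℂ} {x : V} (hx : x ≠ 0)
    (e : polar c a s s x = μ • x) : ∃ k : ℕ, k ≤ 2 * Fintype.card ι ∧ μ = k := by
  have h0 := LinearMap.congr_fun (aeval_polar_eq_zero h hvac hspan s) x
  rw [Module.End.aeval_apply_of_mem_apply_eq_smul e, LinearMap.zero_apply, smul_eq_zero,
    or_iff_left hx, eval_prod, Finset.prod_eq_zero_iff] at h0
  obtain ⟨r, hr, h0⟩ := h0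
  rw [Finset.mem_map] at hr
  obtain ⟨k, hk, rfl⟩ := hr
  refine ⟨k, Nat.le_of_lt_succ (Finset.mem_range.mp hk), ?_⟩
  simpa [sub_eq_zero] using h0

include h hvac hspan in
theorem mem_span_vac_of_polar_eq_zero {x : V} (h0 : polar c a 0 0 x = 0)
    (h1 : polar c a 1 1 x = 0) : x ∈ Submodule.span ℂ {vac} := by
  set q : ℂ[X] := ∏ k ∈ Finset.Icc 1 (4 * Fintype.card ι), (X - C (k : ℂ)) with hq
  set N : Module.End ℂ V := polar c a 0 0 + polar c a 1 1 with hN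
  have hNx : N x = (0 : ℂ) • x := by rw [hN, LinearMap.add_apply, h0, h1, add_zero, zero_smul]
  have key : ∀ y, aeval N q y ∈ Submodule.span ℂ {vac} := by
    intro y
    have hy : y ∈ Submodule.span ℂ {y | IsOccupationVector c a vac y} := by
      rw [h.span_isOccupationVector hvac hspan]; exact Submodule.mem_top
    induction hy using Submodule.span_induction with
    | mem y hy =>
      obtain ⟨k, hk, e, f⟩ := IsOccupationVector.polar_apply hy 0
      obtain ⟨k', hk', e', f'⟩ := IsOccupationVector.polar_apply hy 1
      have hNy : N y = ((k + k' : ℕ) : ℂ) • y := by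
        rw [hN, LinearMap.add_apply, e, e', Nat.cast_add, add_smul]
      rw [Module.End.aeval_apply_of_mem_apply_eq_smul hNy]
      rcases hy.occupied with hv | ⟨s, i, hi⟩
      · exact Submodule.smul_mem _ _ hv
      · have : 1 ≤ k + k' := by
          fin_cases s
          · have := f ⟨i, hi⟩; omega
          · have := f' ⟨i, hi⟩; omega
        rw [hq, eval_prod, Finset.prod_eq_zero (i := k + k'), zero_smul]
        · exact Submodule.zero_mem _
        · rw [Finset.mem_Icc]; omega
        · simp
    | zero => rw [map_zero]; exact Submodule.zero_mem _
    | add x y _ _ hx hy => rw [map_add]; exact Submodule.add_mem _ hx hy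
    | smul r x _ hx => rw [map_smul]; exact Submodule.smul_mem _ r hx
  have hx := key x
  rw [Module.End.aeval_apply_of_mem_apply_eq_smul hNx] at hx
  refine (Submodule.smul_mem_iff _ ?_).mp hx
  rw [hq, eval_prod, Finset.prod_ne_zero_iff]
  intro k hk
  have : k ≠ 0 := by rw [Finset.mem_Icc] at hk; omega
  simpa using this

/-- The subspace killed by the operators `spLie c a i j`. -/
def spInvariants (c a : Fin 2 → ι ⊕ ι → Module.End ℂ V) : Submodule ℂ V :=
  ⨅ i, ⨅ j, LinearMap.ker (spLie c a i j)

omit [DecidableEq ι] in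
theorem mem_spInvariants {x : V} :
    x ∈ spInvariants c a ↔ ∀ i j, spLie c a i j x = 0 := by
  simp [spInvariants, Submodule.mem_iInf]

omit [DecidableEq ι] in
theorem mem_spInvariants_of_lie_eq_zero {T : Module.End ℂ V} (hT : ∀ i j, ⁅spLie c a i j, T⁆ = 0)
    {x : V} (hx : x ∈ spInvariants c a) : T x ∈ spInvariants c a := by
  rw [mem_spInvariants] at hx ⊢
  intro i j
  have := LinearMap.congr_fun (hT i j) x
  rw [Ring.lie_def, LinearMap.sub_apply, Module.End.mul_apply, Module.End.mul_apply, hx i j,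
    map_zero, sub_zero] at this
  exact this

theorem apply_apply_of_lie_eq {A T : Module.End ℂ V} {μ ν : ℂ} {x : V}
    (hA : ⁅A, T⁆ = ν • T) (hx : A x = μ • x) : A (T x) = (μ + ν) • T x := by
  have := LinearMap.congr_fun hA x
  rw [Ring.lie_def, LinearMap.sub_apply, Module.End.mul_apply, Module.End.mul_apply, hx,
    map_smul, LinearMap.smul_apply, sub_eq_iff_eq_add] at this
  rw [this, add_smul, add_comm]

include h in
theorem capelli_apply {x : V} (hx : x ∈ spInvariants c a) {d₁ d₂ : ℂ}
    (h₁ : polar c a 0 0 x = d₁ • x) (h₂ : polar c a 1 1 x = d₂ • x) :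
    (d₁ * (2 * Fintype.card ι + 4 - d₁) + d₂ * (2 * Fintype.card ι + 2 - d₂)) • x =
      (2 : ℂ) • polar c a 0 1 (polar c a 1 0 x) -
        (spPair c 0 0 (spPair a 0 0 x) + spPair c 0 1 (spPair a 0 1 x) +
          spPair c 1 0 (spPair a 1 0 x) + spPair c 1 1 (spPair a 1 1 x)) := by
  rw [mem_spInvariants] at hx
  have k := fun t => LinearMap.congr_fun (h.capelli t) x
  have k0 := k 0
  have k1 := k 1
  have k2 := LinearMap.congr_fun (h.lie_polar_polar 1 0 0 1) x
  simp only [LinearMap.sum_apply, Module.End.mul_apply, hx, map_zero, Finset.sum_const_zero,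
    LinearMap.add_apply, LinearMap.sub_apply, LinearMap.smul_apply, Fin.sum_univ_two, h₁, h₂,
    map_smul, Ring.lie_def, if_true, Fintype.card_fin, smul_smul] at k0 k1 k2
  push_cast at k0 k1
  linear_combination (norm := module) k2 - k0 - k1

include h hvac hspan in
theorem mem_of_polar_apply_eq (B : Submodule ℂ V) (hB : vac ∈ B)
    (hP : ∀ s t, ∀ x ∈ B, spPair c s t x ∈ B) (hE : ∀ s t, ∀ x ∈ B, polar c a s t x ∈ B) (n : ℕ) :
    ∀ (d₁ d₂ : ℤ) (x : V), x ∈ spInvariants c a → polar c a 0 0 x = (d₁ : ℂ) • x →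
      polar c a 1 1 x = (d₂ : ℂ) • x → 2 * d₁ + d₂ < n → x ∈ B := by
  induction n with
  | zero =>
    intro d₁ d₂ x _ h₁ h₂ hn
    by_contra hxB
    have hx0 : x ≠ 0 := fun e => hxB (e ▸ B.zero_mem)
    obtain ⟨k₁, hk₁, e₁⟩ := polar_eigenvalue_mem h hvac hspan hx0 h₁
    obtain ⟨k₂, hk₂, e₂⟩ := polar_eigenvalue_mem h hvac hspan hx0 h₂
    norm_cast at e₁ e₂
    push_cast at hn
    omega
  | succ n ih =>
    intro d₁ d₂ x hx h₁ h₂ hn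
    by_contra hxB
    have hx0 : x ≠ 0 := fun e => hxB (e ▸ B.zero_mem)
    obtain ⟨k₁, hk₁, e₁⟩ := polar_eigenvalue_mem h hvac hspan hx0 h₁
    obtain ⟨k₂, hk₂, e₂⟩ := polar_eigenvalue_mem h hvac hspan hx0 h₂
    norm_cast at e₁ e₂
    push_cast at hn
    apply hxB
    have hcap := capelli_apply h hx h₁ h₂
    have hM : ∀ s t, spPair a s t x ∈ B := by
      intro s t
      refine ih (d₁ - (if s = 0 then 1 else 0) - (if t = 0 then 1 else 0))
        (d₂ - (if s = 1 then 1 else 0) - (if t = 1 then 1 else 0)) _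
        (mem_spInvariants_of_lie_eq_zero (fun i j => h.lie_spLie_pair_a i j s t) hx) ?_ ?_ ?_
      · rw [apply_apply_of_lie_eq (ν := -(if s = 0 then 1 else 0) - (if t = 0 then 1 else 0)) ?_ h₁]
        · push_cast; congr 1; ring
        · rw [h.lie_polar_pair_a]
          fin_cases s <;> fin_cases t <;> simp <;> module
      · rw [apply_apply_of_lie_eq (ν := -(if s = 1 then 1 else 0) - (if t = 1 then 1 else 0)) ?_ h₂]
        · push_cast; congr 1; ring
        · rw [h.lie_polar_pair_a]
          fin_cases s <;> fin_cases t <;> simp <;> module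
      · fin_cases s <;> fin_cases t <;> simp <;> omega
    have hE' : polar c a 1 0 x ∈ B := by
      refine ih (d₁ - 1) (d₂ + 1) _
        (mem_spInvariants_of_lie_eq_zero (fun i j => h.lie_spLie_polar i j 1 0) hx) ?_ ?_ (by omega)
      · rw [apply_apply_of_lie_eq (ν := -1) ?_ h₁]
        · push_cast; congr 1
        · rw [h.lie_polar_polar]; simp
      · rw [apply_apply_of_lie_eq (ν := 1) ?_ h₂]
        · push_cast; congr 1
        · rw [h.lie_polar_polar]; simp
    by_cases hd : k₁ = 0 ∧ k₂ = 0
    · obtain ⟨rfl, rfl⟩ := hd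
      rw [e₁, Nat.cast_zero, Int.cast_zero, zero_smul] at h₁
      rw [e₂, Nat.cast_zero, Int.cast_zero, zero_smul] at h₂
      exact (Submodule.span_singleton_le_iff_mem _ _).mpr hB
        (mem_span_vac_of_polar_eq_zero h hvac hspan h₁ h₂)
    · have hm := B.sub_mem (B.smul_mem 2 (hE 0 1 _ hE'))
        (B.add_mem (B.add_mem (B.add_mem (hP 0 0 _ (hM 0 0)) (hP 0 1 _ (hM 0 1)))
          (hP 1 0 _ (hM 1 0))) (hP 1 1 _ (hM 1 1)))
      rw [← hcap] at hm
      refine (Submodule.smul_mem_iff B ?_).mp hm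
      subst e₁ e₂
      obtain ⟨p₁, hp₁⟩ := Nat.exists_eq_add_of_le hk₁
      obtain ⟨p₂, hp₂⟩ := Nat.exists_eq_add_of_le hk₂
      have q₁ : (2 * Fintype.card ι : ℂ) = k₁ + p₁ := by exact_mod_cast hp₁
      have q₂ : (2 * Fintype.card ι : ℂ) = k₂ + p₂ := by exact_mod_cast hp₂
      have : ((k₁ : ℤ) : ℂ) * (2 * Fintype.card ι + 4 - (k₁ : ℤ)) +
          (k₂ : ℤ) * (2 * Fintype.card ι + 2 - (k₂ : ℤ)) =
          ((k₁ * (p₁ + 4) + k₂ * (p₂ + 2) : ℕ) : ℂ) := by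
        push_cast
        linear_combination (k₁ : ℂ) * q₁ + k₂ * q₂
      rw [this, Nat.cast_ne_zero]
      rcases Nat.eq_zero_or_pos k₁ with h0 | h0
      · have : 0 < k₂ := by omega
        positivity
      · positivity

/-- The span of the vacuum under the operators `spPair c s t`. -/
def pairSpan (c : Fin 2 → ι ⊕ ι → Module.End ℂ V) (vac : V) : Submodule ℂ V :=
  sInf {B | vac ∈ B ∧ ∀ s t, ∀ x ∈ B, spPair c s t x ∈ B}

omit [DecidableEq ι] in
theorem vac_mem_pairSpan : vac ∈ pairSpan c vac :=
  Submodule.mem_sInf.mpr fun _ hB => hB.1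

omit [DecidableEq ι] in
theorem spPair_mem_pairSpan (s t : Fin 2) {x : V} (hx : x ∈ pairSpan c vac) :
    spPair c s t x ∈ pairSpan c vac :=
  Submodule.mem_sInf.mpr fun B hB => hB.2 s t x (Submodule.mem_sInf.mp hx B hB)

include h hvac in
theorem polar_mem_pairSpan (s t : Fin 2) {x : V} (hx : x ∈ pairSpan c vac) :
    polar c a s t x ∈ pairSpan c vac := by
  have hle : pairSpan c vac ≤
      pairSpan c vac ⊓ (pairSpan c vac).comap (polar c a s t) := by
    refine sInf_le ⟨⟨vac_mem_pairSpan, ?_⟩, fun u v y hy => ⟨spPair_mem_pairSpan u v hy.1, ?_⟩⟩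
    · have : polar c a s t vac = 0 := by
        simp [polar, hvac, -Fintype.sum_sum_type]
      rw [SetLike.mem_coe, Submodule.mem_comap, this]
      exact Submodule.zero_mem _
    · have e := LinearMap.congr_fun (h.lie_polar_pair_c s t u v) y
      rw [Ring.lie_def, LinearMap.sub_apply, Module.End.mul_apply, Module.End.mul_apply,
        sub_eq_iff_eq_add] at e
      rw [SetLike.mem_coe, Submodule.mem_comap, e]
      refine Submodule.add_mem _ ?_ (spPair_mem_pairSpan u v hy.2)
      rw [LinearMap.add_apply]
      refine Submodule.add_mem _ ?_ ?_
      · split_ifs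
        · exact spPair_mem_pairSpan _ _ hy.1
        · exact Submodule.zero_mem _
      · split_ifs
        · exact spPair_mem_pairSpan _ _ hy.1
        · exact Submodule.zero_mem _
  exact (hle hx).2

include h hvac hspan in
theorem spInvariants_le_pairSpan : spInvariants c a ≤ pairSpan c vac := by
  classical
  have hstab : ∀ s, ∀ x ∈ spInvariants c a, polar c a s s x ∈ spInvariants c a := fun s x hx =>
    mem_spInvariants_of_lie_eq_zero (fun i j => h.lie_spLie_polar i j s s) hx
  refine (le_iSup_inf_eigenspace _ _ (aeval_polar_eq_zero h hvac hspan 0) _ (hstab 0)).trans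
    (iSup₂_le fun r₁ hr₁ => ?_)
  have hcomm : ∀ x ∈ spInvariants c a ⊓ Module.End.eigenspace (polar c a 0 0) r₁,
      polar c a 1 1 x ∈ spInvariants c a ⊓ Module.End.eigenspace (polar c a 0 0) r₁ := by
    intro x hx
    refine ⟨hstab 1 x hx.1, ?_⟩
    have := apply_apply_of_lie_eq (A := polar c a 0 0) (T := polar c a 1 1) (ν := 0)
      (by rw [h.lie_polar_polar]; simp) (Module.End.mem_eigenspace_iff.mp hx.2)
    rw [SetLike.mem_coe, Module.End.mem_eigenspace_iff, this, add_zero]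
  refine (le_iSup_inf_eigenspace _ _ (aeval_polar_eq_zero h hvac hspan 1) _ hcomm).trans
    (iSup₂_le fun r₂ hr₂ => ?_)
  rintro x ⟨⟨hx, h₁⟩, h₂⟩
  rw [SetLike.mem_coe, Module.End.mem_eigenspace_iff] at h₁ h₂
  rw [Finset.mem_map] at hr₁ hr₂
  obtain ⟨k₁, -, rfl⟩ := hr₁
  obtain ⟨k₂, -, rfl⟩ := hr₂
  exact mem_of_polar_apply_eq h hvac hspan _ vac_mem_pairSpan
    (fun s t _ hx => spPair_mem_pairSpan s t hx)
    (fun s t _ hx => polar_mem_pairSpan h hvac s t hx) (2 * k₁ + k₂ + 1) k₁ k₂ x hx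
    (by simpa using h₁) (by simpa using h₂) (by push_cast; omega)

end Main

end FockSpace

section Symplectic

variable {m : ℕ}

theorem Jstd_apply (i j : Fin m ⊕ Fin m) :
    Jstd m i j = if j = i.swap then spSign i else 0 := by
  rcases i with i | i <;> rcases j with j | j <;>
    simp [Jstd, spSign, Matrix.one_apply, eq_comm]
  split_ifs <;> simp

theorem Jstd_mul_self : Jstd m * Jstd m = -1 := by
  simp [Jstd, Matrix.fromBlocks_multiply, ← Matrix.fromBlocks_one, Matrix.fromBlocks_neg]

theorem Jstd_transpose : (Jstd m).transpose = -Jstd m := by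
  simp [Jstd, Matrix.fromBlocks_transpose, Matrix.fromBlocks_neg]

theorem IsSymp.mul_Jstd_mul_transpose {g : Matrix (Fin m ⊕ Fin m) (Fin m ⊕ Fin m) ℂ}
    (hg : IsSymp m g) : g * Jstd m * g.transpose = Jstd m := by
  have h1 : (-(Jstd m * g.transpose * Jstd m)) * g = 1 := by
    rw [Matrix.neg_mul, Matrix.mul_assoc, Matrix.mul_assoc, ← Matrix.mul_assoc g.transpose, hg,
      Jstd_mul_self, neg_neg]
  have h2 := mul_eq_one_comm.mp h1
  have h3 : g * Jstd m * g.transpose * Jstd m = -1 := by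
    rw [← h2]; simp only [Matrix.mul_neg, neg_neg, Matrix.mul_assoc]
  have h4 := congrArg (fun A => A * -Jstd m) h3
  simpa [Matrix.mul_assoc, Jstd_mul_self] using h4

/-- The linear form `Ω(v, ·)`. -/
def omegaForm (v : Cn2 m) : Module.Dual ℂ (Cn2 m) := Matrix.toBilin' (Jstd m) v

theorem omegaForm_apply (v w : Cn2 m) : omegaForm v w = v ⬝ᵥ (Jstd m).mulVec w :=
  Matrix.toBilin'_apply' _ _ _

theorem omegaForm_single (i : Fin m ⊕ Fin m) :
    omegaForm (Pi.single i 1) = spSign i • LinearMap.proj i.swap := by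
  refine LinearMap.ext fun w => ?_
  rw [omegaForm_apply, single_one_dotProduct, Matrix.mulVec, dotProduct]
  simp only [Jstd_apply, ite_mul, zero_mul, Finset.sum_ite_eq', Finset.mem_univ, if_true]
  simp

theorem vecMul_Jstd (v : Cn2 m) : Matrix.vecMul v (Jstd m) = -(Jstd m).mulVec v := by
  rw [← Matrix.mulVec_transpose, Jstd_transpose, Matrix.neg_mulVec]

theorem dotProduct_Jstd_mulVec_self (v : Cn2 m) : v ⬝ᵥ (Jstd m).mulVec v = 0 := by
  have h : v ⬝ᵥ (Jstd m).mulVec v = -(v ⬝ᵥ (Jstd m).mulVec v) := by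
    conv_lhs => rw [Matrix.dotProduct_mulVec, vecMul_Jstd, neg_dotProduct, dotProduct_comm]
  exact self_eq_neg.mp h

/-- The symplectic transvection `w ↦ w + r Ω(v, w) v`. -/
def transvectionMatrix (r : ℂ) (v : Cn2 m) : Matrix (Fin m ⊕ Fin m) (Fin m ⊕ Fin m) ℂ :=
  1 + r • Matrix.vecMulVec v (Matrix.vecMul v (Jstd m))

theorem transvectionMatrix_mulVec (r : ℂ) (v w : Cn2 m) :
    (transvectionMatrix r v).mulVec w = w + (r * omegaForm v w) • v := by
  rw [transvectionMatrix, Matrix.add_mulVec, Matrix.one_mulVec, Matrix.smul_mulVec,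
    Matrix.vecMulVec_mulVec, ← Matrix.dotProduct_mulVec, ← omegaForm_apply, op_smul_eq_smul,
    smul_smul]

theorem isSymp_transvectionMatrix (r : ℂ) (v : Cn2 m) : IsSymp m (transvectionMatrix r v) := by
  have hA : Matrix.vecMulVec v (Matrix.vecMul v (Jstd m)) = Matrix.vecMulVec v v * Jstd m :=
    (Matrix.vecMulVec_mul v v (Jstd m)).symm
  have hAJA : Matrix.vecMulVec v v * (Jstd m * Matrix.vecMulVec v v) = 0 := by
    rw [Matrix.mul_vecMulVec, Matrix.vecMulVec_mul_vecMulVec, dotProduct_Jstd_mulVec_self]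
    simp
  have hAT : (Matrix.vecMulVec v v).transpose = Matrix.vecMulVec v v :=
    Matrix.transpose_vecMulVec v v
  rw [IsSymp, transvectionMatrix, hA]
  generalize Matrix.vecMulVec v v = A at hAJA hAT
  rw [Matrix.transpose_add, Matrix.transpose_one, Matrix.transpose_smul, Matrix.transpose_mul, hAT,
    Jstd_transpose]
  have h0 : Jstd m * (A * (Jstd m * (A * Jstd m))) = 0 := by
    rw [← Matrix.mul_assoc (Jstd m) A (Jstd m), ← Matrix.mul_assoc A, hAJA, Matrix.zero_mul,
      Matrix.mul_zero]
  simp only [Matrix.add_mul, Matrix.mul_add, Matrix.one_mul, Matrix.mul_one, Matrix.neg_mul,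
    Matrix.smul_mul, Matrix.mul_smul, Matrix.mul_assoc, smul_neg, h0]
  simp

/-- The two inclusions of the standard representation in `Wdiag m`. -/
def diagInj (m : ℕ) : Fin 2 → Cn2 m →ₗ[ℂ] Wdiag m :=
  ![LinearMap.inl ℂ (Cn2 m) (Cn2 m), LinearMap.inr ℂ (Cn2 m) (Cn2 m)]

/-- The two projections of `Wdiag m` to the standard representation. -/
def diagProj (m : ℕ) : Fin 2 → Wdiag m →ₗ[ℂ] Cn2 m :=
  ![LinearMap.fst ℂ (Cn2 m) (Cn2 m), LinearMap.snd ℂ (Cn2 m) (Cn2 m)]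

theorem diagProj_diagInj (s t : Fin 2) (v : Cn2 m) :
    diagProj m s (diagInj m t v) = if s = t then v else 0 := by
  fin_cases s <;> fin_cases t <;> simp [diagProj, diagInj]

theorem prodMap_diagInj (f : Cn2 m →ₗ[ℂ] Cn2 m) (s : Fin 2) (v : Cn2 m) :
    LinearMap.prodMap f f (diagInj m s v) = diagInj m s (f v) := by
  fin_cases s <;> simp [diagInj]

/-- Left multiplication by the `i`-th basis vector of the copy `s`. -/
def diagCreation (m : ℕ) (s : Fin 2) (i : Fin m ⊕ Fin m) :
    Module.End ℂ (ExteriorAlgebra ℂ (Wdiag m)) :=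
  creation (diagInj m s (Pi.single i 1))

/-- Contraction by the `i`-th coordinate form of the copy `s`. -/
def diagAnnihilation (m : ℕ) (s : Fin 2) (i : Fin m ⊕ Fin m) :
    Module.End ℂ (ExteriorAlgebra ℂ (Wdiag m)) :=
  annihilation ((LinearMap.proj i).comp (diagProj m s))

theorem isCAR_diag (m : ℕ) : IsCAR (diagCreation m) (diagAnnihilation m) where
  cc _ _ _ _ := creation_mul_creation _ _
  aa _ _ _ _ := annihilation_mul_annihilation _ _
  ac s i t j := by
    refine (annihilation_mul_creation _ _).trans ?_
    rw [LinearMap.comp_apply, diagProj_diagInj]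
    by_cases hs : s = t
    · by_cases hi : i = j
      · simp [hs, hi, diagCreation, diagAnnihilation]
      · simp [hs, hi, diagCreation, diagAnnihilation]
    · simp [hs, diagCreation, diagAnnihilation]

theorem diagAnnihilation_one (s : Fin 2) (i : Fin m ⊕ Fin m) : diagAnnihilation m s i 1 = 0 :=
  annihilation_one _

theorem eq_top_of_diagCreation_mem (p : Submodule ℂ (ExteriorAlgebra ℂ (Wdiag m))) (h1 : 1 ∈ p)
    (hp : ∀ s i, ∀ x ∈ p, diagCreation m s i x ∈ p) : p = ⊤ := by
  refine eq_top_of_creation_mem p h1 fun w x hx => ?_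
  have key : ∀ s v, creation (diagInj m s v) x ∈ p := by
    intro s v
    have hv : diagInj m s v = ∑ i, v i • diagInj m s (Pi.single i 1) := by
      conv_lhs => rw [pi_eq_sum_univ' v]
      simp only [map_sum, map_smul]
    rw [creation_apply, hv, map_sum, Finset.sum_mul]
    refine Submodule.sum_mem _ fun i _ => ?_
    rw [map_smul, smul_mul_assoc]
    exact p.smul_mem _ (hp s i x hx)
  have hw : w = diagInj m 0 w.1 + diagInj m 1 w.2 := by simp [diagInj]
  rw [hw, creation_add]
  exact p.add_mem (key 0 w.1) (key 1 w.2)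

theorem diagDerivation_self {x : ExteriorAlgebra ℂ (Wdiag m)} (hx : x ∈ diagSympInvAlg m)
    (v : Cn2 m) :
    creation (diagInj m 0 v) (annihilation ((omegaForm v).comp (diagProj m 0)) x) +
      creation (diagInj m 1 v) (annihilation ((omegaForm v).comp (diagProj m 1)) x) = 0 := by
  have hg : ∀ (r : ℂ) (w : Wdiag m), LinearMap.prodMap (transvectionMatrix r v).mulVecLin
      (transvectionMatrix r v).mulVecLin w =
      w + (r * omegaForm v w.1) • diagInj m 0 v + (r * omegaForm v w.2) • diagInj m 1 v := by
    intro r w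
    ext1 <;> simp [transvectionMatrix_mulVec, diagInj]
  refine derivation_eq_zero_of_map_eq _ _ _ _ ?_
    (LinearMap.prodMap (transvectionMatrix 1 v).mulVecLin (transvectionMatrix 1 v).mulVecLin)
    (LinearMap.prodMap (transvectionMatrix (-1) v).mulVecLin
      (transvectionMatrix (-1) v).mulVecLin) ?_ ?_ x
    (hx _ (isSymp_transvectionMatrix 1 v)) (hx _ (isSymp_transvectionMatrix (-1) v))
  · rw [LinearMap.comp_apply, diagProj_diagInj]
    simp
  · intro w
    rw [hg]
    simp [diagProj]
  · intro w
    rw [hg]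
    simp [diagProj, sub_eq_add_neg]

theorem omegaForm_add (u v : Cn2 m) : omegaForm (u + v) = omegaForm u + omegaForm v :=
  map_add _ _ _

theorem diagDerivation_polarized {x : ExteriorAlgebra ℂ (Wdiag m)} (hx : x ∈ diagSympInvAlg m)
    (u v : Cn2 m) :
    ∑ s, creation (diagInj m s u) (annihilation ((omegaForm v).comp (diagProj m s)) x) +
      ∑ s, creation (diagInj m s v) (annihilation ((omegaForm u).comp (diagProj m s)) x) = 0 := by
  have huv := diagDerivation_self hx (u + v)
  have hu := diagDerivation_self hx u
  have hv := diagDerivation_self hx v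
  simp only [omegaForm_add, LinearMap.add_comp, map_add, creation_add, annihilation_add,
    LinearMap.add_apply] at huv
  rw [Fin.sum_univ_two, Fin.sum_univ_two]
  linear_combination (norm := module) huv - hu - hv

theorem diagSympInvAlg_le_spInvariants {x : ExteriorAlgebra ℂ (Wdiag m)}
    (hx : x ∈ diagSympInvAlg m) : x ∈ spInvariants (diagCreation m) (diagAnnihilation m) := by
  rw [mem_spInvariants]
  intro i j
  have h := diagDerivation_polarized hx (Pi.single i 1) (Pi.single j.swap 1)
  simp only [omegaForm_single, LinearMap.smul_comp, annihilation_smul, LinearMap.smul_apply,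
    map_smul, Sum.swap_swap, ← Finset.smul_sum, spSign_swap] at h
  have h' := congrArg (fun y => -spSign j • y) h
  simp only [smul_add, smul_smul, smul_zero] at h'
  have hj : -spSign j * -spSign j = 1 := by rw [neg_mul_neg, spSign_mul_self]
  rw [hj, one_smul, neg_mul, neg_smul, mul_comm (spSign j), Finset.smul_sum,
    ← sub_eq_add_neg, ← Finset.sum_sub_distrib] at h'
  rw [spLie, LinearMap.sum_apply]
  exact h'

/-- The invariant bivector pairing the copies `s` and `t`. -/
def diagPair (m : ℕ) (s t : Fin 2) : ExteriorAlgebra ℂ (Wdiag m) :=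
  ∑ i, ∑ j, Jstd m i j • (ExteriorAlgebra.ι ℂ (diagInj m s (Pi.single i 1)) *
    ExteriorAlgebra.ι ℂ (diagInj m t (Pi.single j 1)))

theorem diagPair_eq (s t : Fin 2) :
    diagPair m s t = ∑ i, spSign i • (ExteriorAlgebra.ι ℂ (diagInj m s (Pi.single i 1)) *
      ExteriorAlgebra.ι ℂ (diagInj m t (Pi.single i.swap 1))) := by
  refine Finset.sum_congr rfl fun i _ => ?_
  simp only [Jstd_apply, ite_smul, zero_smul, Finset.sum_ite_eq', Finset.mem_univ, if_true]

theorem spPair_diagCreation_apply (s t : Fin 2) (x : ExteriorAlgebra ℂ (Wdiag m)) :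
    spPair (diagCreation m) s t x = diagPair m s t * x := by
  rw [diagPair_eq, Finset.sum_mul, spPair, LinearMap.sum_apply]
  refine Finset.sum_congr rfl fun i _ => ?_
  rw [smul_mul_assoc, mul_assoc]
  rfl

theorem sum_sum_sum_sum_comm {α E : Type*} [Fintype α] [AddCommMonoid E]
    (f : α → α → α → α → E) :
    ∑ i, ∑ j, ∑ k, ∑ l, f i j k l = ∑ k, ∑ l, ∑ i, ∑ j, f i j k l := by
  calc ∑ i, ∑ j, ∑ k, ∑ l, f i j k l = ∑ i, ∑ k, ∑ j, ∑ l, f i j k l :=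
        Finset.sum_congr rfl fun _ _ => Finset.sum_comm
    _ = ∑ k, ∑ i, ∑ j, ∑ l, f i j k l := Finset.sum_comm
    _ = ∑ k, ∑ i, ∑ l, ∑ j, f i j k l :=
        Finset.sum_congr rfl fun _ _ => Finset.sum_congr rfl fun _ _ => Finset.sum_comm
    _ = ∑ k, ∑ l, ∑ i, ∑ j, f i j k l :=
        Finset.sum_congr rfl fun _ _ => Finset.sum_comm

theorem diagPair_mem (s t : Fin 2) : diagPair m s t ∈ diagSympInvAlg m := by
  intro g hg
  have hsingle : ∀ (s : Fin 2) i, ExteriorAlgebra.ι ℂ (diagInj m s (g.mulVec (Pi.single i 1))) =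
      ∑ k, g k i • ExteriorAlgebra.ι ℂ (diagInj m s (Pi.single k 1)) := by
    intro s i
    conv_lhs => rw [pi_eq_sum_univ' (g.mulVec (Pi.single i 1))]
    simp
  simp only [diagPair, map_sum, map_smul, map_mul, ExteriorAlgebra.map_apply_ι, prodMap_diagInj,
    Matrix.mulVecLin_apply, hsingle, Finset.sum_mul_sum, smul_mul_smul_comm, Finset.smul_sum,
    smul_smul]
  have hentry : ∀ k l, ∑ i, ∑ j, Jstd m i j * (g k i * g l j) = Jstd m k l := by
    intro k l
    conv_rhs => rw [← hg.mul_Jstd_mul_transpose]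
    simp only [Matrix.mul_apply, Matrix.transpose_apply, Finset.sum_mul]
    rw [Finset.sum_comm]
    exact Finset.sum_congr rfl fun j _ => Finset.sum_congr rfl fun i _ => by ring
  refine Eq.trans ?_ (Finset.sum_congr rfl fun k _ => Finset.sum_congr rfl fun l _ =>
    congrArg (· • _) (hentry k l))
  simp only [Finset.sum_smul]
  exact sum_sum_sum_sum_comm _

theorem diagPair_zero_zero : diagPair m 0 0 = (2 : ℂ) • omega₁ m := by
  rw [diagPair_eq, Fintype.sum_sum_type, omega₁, two_smul]
  congr 1
  · simp [spSign, diagInj]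
  · refine Finset.sum_congr rfl fun i _ => ?_
    have := ExteriorAlgebra.ι_add_mul_swap (R := ℂ) (M := Wdiag m) (Pi.single (Sum.inl i) 1, 0)
      (Pi.single (Sum.inr i) 1, 0)
    simpa [spSign, diagInj] using (eq_neg_of_add_eq_zero_left this).symm

theorem diagPair_one_one : diagPair m 1 1 = (2 : ℂ) • omega₂ m := by
  rw [diagPair_eq, Fintype.sum_sum_type, omega₂, two_smul]
  congr 1
  · simp [spSign, diagInj]
  · refine Finset.sum_congr rfl fun i _ => ?_
    have := ExteriorAlgebra.ι_add_mul_swap (R := ℂ) (M := Wdiag m) (0, Pi.single (Sum.inl i) 1)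
      (0, Pi.single (Sum.inr i) 1)
    simpa [spSign, diagInj] using (eq_neg_of_add_eq_zero_left this).symm

theorem diagPair_zero_one : diagPair m 0 1 = tauForm m := by
  rw [diagPair_eq, Fintype.sum_sum_type, tauForm, ← Finset.sum_add_distrib]
  refine Finset.sum_congr rfl fun i _ => ?_
  simp [spSign, diagInj, sub_eq_add_neg]

theorem diagPair_one_zero : diagPair m 1 0 = tauForm m := by
  rw [diagPair_eq, Fintype.sum_sum_type, tauForm, ← Finset.sum_add_distrib]
  refine Finset.sum_congr rfl fun i _ => ?_
  have h1 := ExteriorAlgebra.ι_add_mul_swap (R := ℂ) (M := Wdiag m) (Pi.single (Sum.inl i) 1, 0)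
      (0, Pi.single (Sum.inr i) 1)
  have h2 := ExteriorAlgebra.ι_add_mul_swap (R := ℂ) (M := Wdiag m) (Pi.single (Sum.inr i) 1, 0)
      (0, Pi.single (Sum.inl i) 1)
  rw [eq_neg_of_add_eq_zero_left h1, eq_neg_of_add_eq_zero_left h2]
  simp [spSign, diagInj, sub_eq_add_neg, add_comm]

end Symplectic

/-- The algebra of `Sp(2m,ℂ)`-invariant elements of the exterior algebra
`⋀•(ℂ^{2m} ⊕ ℂ^{2m})` (diagonal action) is generated, as a unital `ℂ`-algebra, by the three
invariant 2-forms `ω₁`, `ω₂`, `τ`. -/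
theorem diag_symplectic_invariant_algebra_generated (m : ℕ) (hm : 1 ≤ m) :
    diagSympInvAlg m = Algebra.adjoin ℂ {omega₁ m, omega₂ m, tauForm m} := by
  have hhalf : ∀ y : ExteriorAlgebra ℂ (Wdiag m), y = (2⁻¹ : ℂ) • (2 : ℂ) • y := fun y => by
    rw [smul_smul, inv_mul_cancel₀ two_ne_zero, one_smul]
  refine le_antisymm (fun x hx => ?_) (Algebra.adjoin_le ?_)
  · have hmem : ∀ s t, diagPair m s t ∈ Algebra.adjoin ℂ {omega₁ m, omega₂ m, tauForm m} := by
      have h1 : omega₁ m ∈ Algebra.adjoin ℂ {omega₁ m, omega₂ m, tauForm m} :=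
        Algebra.subset_adjoin (by simp)
      have h2 : omega₂ m ∈ Algebra.adjoin ℂ {omega₁ m, omega₂ m, tauForm m} :=
        Algebra.subset_adjoin (by simp)
      have h3 : tauForm m ∈ Algebra.adjoin ℂ {omega₁ m, omega₂ m, tauForm m} :=
        Algebra.subset_adjoin (by simp)
      rw [Fin.forall_fin_two, Fin.forall_fin_two, Fin.forall_fin_two, diagPair_zero_zero,
        diagPair_zero_one, diagPair_one_zero, diagPair_one_one]
      exact ⟨⟨Subalgebra.smul_mem _ h1 2, h3⟩, h3, Subalgebra.smul_mem _ h2 2⟩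
    have hx' := spInvariants_le_pairSpan (isCAR_diag m) diagAnnihilation_one
      eq_top_of_diagCreation_mem (diagSympInvAlg_le_spInvariants hx)
    refine Submodule.mem_sInf.mp hx' (Subalgebra.toSubmodule (Algebra.adjoin ℂ _))
      ⟨Subalgebra.one_mem _, fun s t y hy => ?_⟩
    rw [spPair_diagCreation_apply]
    exact Subalgebra.mul_mem _ (hmem s t) hy
  · rintro y (rfl | rfl | rfl)
    · rw [hhalf (omega₁ m), ← diagPair_zero_zero]
      exact Subalgebra.smul_mem _ (diagPair_mem 0 0) _
    · rw [hhalf (omega₂ m), ← diagPair_one_one]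
      exact Subalgebra.smul_mem _ (diagPair_mem 1 1) _
    · rw [← diagPair_zero_one]
      exact diagPair_mem 0 1
end
end
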